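/- Let p = {p_i, i ∈ 𝓛} be a strictly stationary random field such that there exist s > 0 and q ≥ d with 1/s + 1/q = 1, E|p_0|^q < ∞, and ∑_{i ∈ 𝓛} α(|i|)^{1/s} < ∞, where α is the strong mixing coefficient of p. If, moreover, the law of p_0 is symmetric (there exists μ ∈ ℝ^d with p_0 − μ equal in distribution to μ − p_0) and E|p_0|^{2q} < ∞, then the perturbed lattice Ξ = {i + p_i + U : i ∈ 𝓛} is class I hyperuniform, i.e. Var(#(Ξ ∩ B_r))/λ^d(B_r) = O(r^{-1}) as r → ∞. -/

import Mathlib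

open MeasureTheory ProbabilityTheory Filter Asymptotics

noncomputable section

/-- The strong mixing coefficient between two sub-σ-fields. -/
def alphaSigma {Ω : Type*} [MeasurableSpace Ω] (P : Measure Ω)
    (m₁ m₂ : MeasurableSpace Ω) : ℝ :=
  sSup {x : ℝ | ∃ A B : Set Ω, MeasurableSet[m₁] A ∧ MeasurableSet[m₂] B ∧
    x = |(P A).toReal * (P B).toReal - (P (A ∩ B)).toReal|}

/-- The σ-field generated by the random variables `p i`, `i ∈ C`. -/
def sigmaGen {Ω ι F : Type*} [MeasurableSpace F] (p : ι → Ω → F) (C : Set ι) :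
    MeasurableSpace Ω :=
  ⨆ i ∈ C, MeasurableSpace.comap (p i) inferInstance

/-- The strong (α-)mixing coefficient of the random field `p`, whose indices are located
at positions `pos`, evaluated at distance `n`. -/
def mixCoef {Ω ι F : Type*} [MeasurableSpace Ω] [MeasurableSpace F]
    {d : ℕ} (P : Measure Ω) (pos : ι → EuclideanSpace ℝ (Fin d))
    (p : ι → Ω → F) (n : ℝ) : ℝ :=
  sSup {x : ℝ | ∃ A B : Finset ι,
    (∀ i ∈ A, ∀ j ∈ B, n ≤ ‖pos i - pos j‖) ∧
    x = alphaSigma P (sigmaGen p (A : Set ι)) (sigmaGen p (B : Set ι))}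


/-- Bessel-type integral. -/
def besJ (ν : ℝ) (l : ℝ) : ℝ := ∫ y in (-1:ℝ)..1, (1 - y^2) ^ ν * Real.cos (l * y)

lemma contBes (ν : ℝ) (hν : 0 ≤ ν) : Continuous (fun y : ℝ => (1 - y^2) ^ ν) := by
  refine Continuous.rpow_const (by fun_prop) (fun x => Or.inr hν)

lemma besJ_deriv (ν : ℝ) (hν : 0 ≤ ν) (l : ℝ) :
    HasDerivAt (besJ ν) (-∫ y in (-1:ℝ)..1, y * (1 - y^2) ^ ν * Real.sin (l * y)) l := by
  have hc := contBes ν hν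
  have h := intervalIntegral.hasDerivAt_integral_of_dominated_loc_of_deriv_le (𝕜 := ℝ) (μ := volume)
    (F := fun l y => (1 - y^2) ^ ν * Real.cos (l * y))
    (F' := fun l y => (1 - y^2) ^ ν * (-Real.sin (l * y) * y)) (x₀ := l) (a := -1) (b := 1)
    (s := Set.univ) (bound := fun y => |(1 - y^2) ^ ν| * |y|) Filter.univ_mem ?_ ?_ ?_ ?_ ?_ ?_
  · refine HasDerivAt.congr_deriv h.2 ?_
    rw [← intervalIntegral.integral_neg]
    congr 1; ext y; ring
  · exact Filter.Eventually.of_forall fun x => (by fun_prop : Continuous _).aestronglyMeasurable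
  · exact (by fun_prop : Continuous _).intervalIntegrable _ _
  · exact (by fun_prop : Continuous _).aestronglyMeasurable
  · refine Filter.Eventually.of_forall fun y _ x _ => ?_
    simp only [norm_mul, Real.norm_eq_abs, abs_neg]
    gcongr
    exact mul_le_of_le_one_left (abs_nonneg _) (Real.abs_sin_le_one _)
  · exact (by fun_prop : Continuous _).intervalIntegrable _ _
  · refine Filter.Eventually.of_forall fun y _ x _ => ?_
    refine HasDerivAt.const_mul _ ?_
    have := (((hasDerivAt_id x).mul_const y).cos)
    simpa using this

lemma besJ_deriv2 (ν : ℝ) (hν : 0 ≤ ν) (l : ℝ) :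
    HasDerivAt (fun l => -∫ y in (-1:ℝ)..1, y * (1 - y^2) ^ ν * Real.sin (l * y))
     (-∫ y in (-1:ℝ)..1, y^2 * (1 - y^2) ^ ν * Real.cos (l * y)) l := by
  have hc := contBes ν hν
  have h := intervalIntegral.hasDerivAt_integral_of_dominated_loc_of_deriv_le (𝕜 := ℝ) (μ := volume)
    (F := fun l y => y * (1 - y^2) ^ ν * Real.sin (l * y))
    (F' := fun l y => y * (1 - y^2) ^ ν * (Real.cos (l * y) * y)) (x₀ := l) (a := -1) (b := 1)
    (s := Set.univ) (bound := fun y => |y * (1 - y^2) ^ ν| * |y|) Filter.univ_mem ?_ ?_ ?_ ?_ ?_ ?_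
  · refine HasDerivAt.fun_neg ?_
    refine HasDerivAt.congr_deriv h.2 ?_
    congr 1; ext y; ring
  · exact Filter.Eventually.of_forall fun x => (by fun_prop : Continuous _).aestronglyMeasurable
  · exact (by fun_prop : Continuous _).intervalIntegrable _ _
  · exact (by fun_prop : Continuous _).aestronglyMeasurable
  · refine Filter.Eventually.of_forall fun y _ x _ => ?_
    rw [norm_mul, Real.norm_eq_abs, Real.norm_eq_abs, abs_mul (Real.cos _)]
    gcongr
    exact mul_le_of_le_one_left (abs_nonneg _) (Real.abs_cos_le_one _)
  · exact (by fun_prop : Continuous _).intervalIntegrable _ _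
  · refine Filter.Eventually.of_forall fun y _ x _ => ?_
    refine HasDerivAt.const_mul _ ?_
    have := (((hasDerivAt_id x).mul_const y).sin)
    simpa using this

lemma besJ_ode (ν : ℝ) (hν : 0 ≤ ν) (l : ℝ) :
    l * ((-∫ y in (-1:ℝ)..1, y^2 * (1 - y^2) ^ ν * Real.cos (l * y)) + besJ ν l)
      = - (2 * (ν + 1)) * (-∫ y in (-1:ℝ)..1, y * (1 - y^2) ^ ν * Real.sin (l * y)) := by
  have hc := contBes ν hν
  have hparts := intervalIntegral.integral_mul_deriv_eq_deriv_mul (a := -1) (b := 1)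
    (u := fun y : ℝ => (1 - y^2) ^ (ν+1)) (v := fun y => Real.sin (l * y))
    (u' := fun y => -(2 * (ν+1)) * (y * (1 - y^2)^ν)) (v' := fun y => l * Real.cos (l * y))
    ?_ ?_ ?_ ?_
  · have h1 : ((1:ℝ) - 1^2) ^ (ν+1) = 0 := by
      norm_num; exact Real.zero_rpow (by linarith)
    have h2 : ((1:ℝ) - (-1)^2) ^ (ν+1) = 0 := by
      norm_num; exact Real.zero_rpow (by linarith)
    rw [h1, h2] at hparts
    have e1 : (-∫ y in (-1:ℝ)..1, y^2 * (1 - y^2) ^ ν * Real.cos (l * y)) + besJ ν l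
        = ∫ y in (-1:ℝ)..1, (1 - y^2)^(ν+1) * Real.cos (l * y) := by
      unfold besJ
      rw [← intervalIntegral.integral_neg, ← intervalIntegral.integral_add]
      · refine intervalIntegral.integral_congr fun y hy => ?_
        rw [Set.uIcc_of_le (by norm_num)] at hy
        have : 0 ≤ 1 - y^2 := by nlinarith [hy.1, hy.2]
        rcases this.eq_or_lt with h | h
        · have hy2 : y^2 = 1 := by linarith
          simp only [hy2, sub_self]
          rw [Real.zero_rpow (show ν + 1 ≠ 0 by linarith)]; ring
        · simp only [Real.rpow_add_one h.ne']; ring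
      · exact (by fun_prop : Continuous _).intervalIntegrable _ _
      · exact (by fun_prop : Continuous _).intervalIntegrable _ _
    rw [e1]
    have e2 : ∫ y in (-1:ℝ)..1, (1 - y^2) ^ (ν+1) * (l * Real.cos (l * y)) =
       l * ∫ y in (-1:ℝ)..1, (1 - y^2)^(ν+1) * Real.cos (l * y) := by
      rw [← intervalIntegral.integral_const_mul]; congr 1; ext y; ring
    have e3 : ∫ y in (-1:ℝ)..1, -(2 * (ν+1)) * (y * (1 - y^2)^ν) * Real.sin (l * y) =
       -(2 * (ν+1)) * ∫ y in (-1:ℝ)..1, y * (1 - y^2) ^ ν * Real.sin (l * y) := by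
      rw [← intervalIntegral.integral_const_mul]; congr 1; ext y; ring
    rw [e2, e3] at hparts
    rw [hparts]; ring
  · intro y _
    have h := ((hasDerivAt_const y (1:ℝ)).sub (hasDerivAt_pow 2 y)).rpow_const (p := ν+1)
      (Or.inr (by linarith))
    refine HasDerivAt.congr_deriv h ?_
    simp; ring
  · intro y _
    have := (((hasDerivAt_id y).const_mul l).sin)
    simpa [mul_comm] using this
  · exact (by fun_prop : Continuous _).intervalIntegrable _ _
  · exact (by fun_prop : Continuous _).intervalIntegrable _ _

/-- decay -/
lemma besJ_bound (ν : ℝ) (hν : 0 ≤ ν) : ∃ C, 0 ≤ C ∧ ∀ l, 0 < l → |besJ ν l| ≤ C * l ^ (-(ν+1)) := by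
  obtain ⟨J1, hJ1⟩ : ∃ J1 : ℝ → ℝ, J1 = fun l => -∫ y in (-1:ℝ)..1, y * (1 - y^2) ^ ν * Real.sin (l * y) := ⟨_, rfl⟩
  obtain ⟨J2, hJ2⟩ : ∃ J2 : ℝ → ℝ, J2 = fun l => -∫ y in (-1:ℝ)..1, y^2 * (1 - y^2) ^ ν * Real.cos (l * y) := ⟨_, rfl⟩
  have hd1 : ∀ l, HasDerivAt (besJ ν) (J1 l) l := fun l => by rw [hJ1]; exact besJ_deriv ν hν l
  have hd2 : ∀ l, HasDerivAt J1 (J2 l) l := fun l => by rw [hJ1, hJ2]; exact besJ_deriv2 ν hν l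
  have hode : ∀ l, l * (J2 l + besJ ν l) = -(2*(ν+1)) * J1 l := fun l => by
    rw [hJ1, hJ2]; exact besJ_ode ν hν l
  -- energy
  let w : ℝ → ℝ := fun l => l ^ (ν+1) * besJ ν l
  let w1 : ℝ → ℝ := fun l => (ν+1) * l ^ ν * besJ ν l + l^(ν+1) * J1 l
  let c := ν * (ν+1)
  have hc0 : 0 ≤ c := by positivity
  have hw : ∀ l, 0 < l → HasDerivAt w (w1 l) l := fun l hl => by
    have := (Real.hasDerivAt_rpow_const (p := ν+1) (Or.inl hl.ne')).mul (hd1 l)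
    refine HasDerivAt.congr_deriv this ?_
    simp [w1]
  have hw1 : ∀ l, 0 < l → HasDerivAt w1 ((c / l^2 - 1) * w l) l := fun l hl => by
    have h1 := ((Real.hasDerivAt_rpow_const (p := ν) (Or.inl hl.ne')).const_mul (ν+1)).mul (hd1 l)
    have h2 := (Real.hasDerivAt_rpow_const (p := ν+1) (Or.inl hl.ne')).mul (hd2 l)
    refine HasDerivAt.congr_deriv (h1.add h2) ?_
    have ho : J2 l = -(2*(ν+1)) * J1 l / l - besJ ν l := by
      have := hode l
      field_simp
      linarith
    have e1 : l ^ (ν+1) = l^(ν-1) * l^2 := by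
      rw [← Real.rpow_natCast l 2, ← Real.rpow_add hl]; congr 1; push_cast; ring
    have e2 : l ^ ν = l^(ν-1) * l := by
      nth_rewrite 3 [← Real.rpow_one l]
      rw [← Real.rpow_add hl]; congr 1; ring
    simp only [w, ho, add_sub_cancel_right, e1, e2, c]
    field_simp
    ring
  let En : ℝ → ℝ := fun l => (w l ^2 + w1 l ^2) * Real.exp (c / l)
  have hEn : ∀ l, 0 < l → HasDerivAt En (- (c / l^2) * (w l - w1 l)^2 * Real.exp (c/l)) l := fun l hl => by
    have h1 := (((hw l hl).pow 2).add ((hw1 l hl).pow 2))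
    have h2 := ((hasDerivAt_inv hl.ne').const_mul c).exp
    have := h1.mul h2
    refine HasDerivAt.congr_deriv this ?_
    simp only [Pi.add_apply, Pi.pow_apply, div_eq_mul_inv]
    field_simp
    push_cast
    ring
  have hmono : ∀ l, 1 ≤ l → En l ≤ En 1 := by
    intro l hl
    have : AntitoneOn En (Set.Ici 1) := by
      refine antitoneOn_of_deriv_nonpos (convex_Ici 1) ?_ ?_ ?_
      · intro x hx
        exact (hEn x (lt_of_lt_of_le one_pos hx)).continuousAt.continuousWithinAt
      · intro x hx
        rw [interior_Ici] at hx
        exact (hEn x (one_pos.trans hx)).differentiableAt.differentiableWithinAt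
      · intro x hx
        rw [interior_Ici] at hx
        rw [(hEn x (one_pos.trans hx)).deriv]
        have : 0 ≤ (c / x^2) * (w x - w1 x)^2 * Real.exp (c/x) := by positivity
        linarith
    exact this (Set.mem_Ici.2 le_rfl) (Set.mem_Ici.2 hl) hl
  have hE1 : 0 ≤ En 1 := by positivity
  have hJb : ∀ l, |besJ ν l| ≤ 2 := fun l => by
    have := intervalIntegral.norm_integral_le_of_norm_le_const (a := -1) (b := 1) (C := 1)
      (f := fun y : ℝ => (1 - y^2) ^ ν * Real.cos (l * y)) ?_
    · unfold besJ; rw [Real.norm_eq_abs] at this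
      refine this.trans ?_; norm_num
    · intro y hy
      rw [Set.uIoc_of_le (by norm_num)] at hy
      have h0 : 0 ≤ 1 - y^2 := by nlinarith [hy.1, hy.2]
      rw [norm_mul, Real.norm_eq_abs, Real.norm_eq_abs, abs_of_nonneg (Real.rpow_nonneg h0 _)]
      exact mul_le_one₀ (Real.rpow_le_one h0 (by nlinarith) hν) (abs_nonneg _) (Real.abs_cos_le_one _)
  refine ⟨2 + Real.sqrt (En 1), by positivity, fun l hl => ?_⟩
  rcases le_total l 1 with h | h
  · have : 1 ≤ l ^ (-(ν+1)) := Real.one_le_rpow_of_pos_of_le_one_of_nonpos hl h (by linarith)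
    have h3 := Real.sqrt_nonneg (En 1)
    nlinarith [hJb l]
  · have h1 := hmono l h
    have h2 : w l ^2 ≤ En 1 := by
      refine le_trans ?_ h1
      have : 1 ≤ Real.exp (c/l) := Real.one_le_exp (by positivity)
      have h3 : 0 ≤ w l ^2 + w1 l^2 := by positivity
      show _ ≤ (w l ^2 + w1 l ^2) * Real.exp (c / l)
      nlinarith [sq_nonneg (w1 l)]
    have h3 : |w l| ≤ Real.sqrt (En 1) := Real.abs_le_sqrt h2
    have h4 : |w l| = l^(ν+1) * |besJ ν l| := by
      simp only [w, abs_mul, abs_of_pos (Real.rpow_pos_of_pos hl _)]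
    have h5 : 0 < l ^ (ν+1) := Real.rpow_pos_of_pos hl _
    rw [Real.rpow_neg hl.le, ← div_eq_mul_inv, le_div_iff₀ h5]
    rw [h4] at h3
    linarith


/-- splitting off the first coordinate -/
def splitE (n : ℕ) : EuclideanSpace ℝ (Fin (n+1)) ≃ᵐ ℝ × EuclideanSpace ℝ (Fin n) :=
  (MeasurableEquiv.toLp 2 (Fin (n+1) → ℝ)).symm.trans
    ((MeasurableEquiv.piFinSuccAbove (fun _ => ℝ) 0).trans
      ((MeasurableEquiv.refl ℝ).prodCongr (MeasurableEquiv.toLp 2 (Fin n → ℝ))))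

lemma splitE_mp (n : ℕ) : MeasurePreserving (splitE n) volume volume := by
  unfold splitE
  refine MeasurePreserving.trans (EuclideanSpace.volume_preserving_symm_measurableEquiv_toLp _) ?_
  refine MeasurePreserving.trans (volume_preserving_piFinSuccAbove (fun _ => ℝ) 0) ?_
  exact (MeasurePreserving.id volume).prod
    ((EuclideanSpace.volume_preserving_symm_measurableEquiv_toLp (Fin n)).symm)

lemma splitE_fst (n : ℕ) (x) : (splitE n x).1 = x 0 := rfl

lemma splitE_norm (n : ℕ) (x) : ‖x‖^2 = (splitE n x).1^2 + ‖(splitE n x).2‖^2 := by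
  rw [EuclideanSpace.norm_sq_eq, EuclideanSpace.norm_sq_eq, Fin.sum_univ_succ]
  simp only [Real.norm_eq_abs, sq_abs]
  rfl

lemma slice_int (n : ℕ) (g : ℝ → ℂ) (hg : Continuous g) :
    ∫ x in Metric.closedBall (0 : EuclideanSpace ℝ (Fin (n+1))) 1, g (x 0) =
     (volume.real (Metric.closedBall (0 : EuclideanSpace ℝ (Fin n)) 1) : ℂ) *
      ∫ t in (-1:ℝ)..1, (((1 - t^2) ^ ((n:ℝ)/2) : ℝ) : ℂ) * g t := by
  let S : Set (ℝ × EuclideanSpace ℝ (Fin n)) := {z | z.1^2 + ‖z.2‖^2 ≤ 1}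
  have hScl : IsClosed S := isClosed_le (by fun_prop) (by fun_prop)
  have hS : MeasurableSet S := hScl.measurableSet
  have h1 : ∫ x in Metric.closedBall (0 : EuclideanSpace ℝ (Fin (n+1))) 1, g (x 0)
      = ∫ z in S, g z.1 := by
    rw [← integral_indicator Metric.isClosed_closedBall.measurableSet, ← integral_indicator hS,
      ← (splitE_mp n).integral_comp']
    congr 1; ext x
    have : x ∈ Metric.closedBall (0 : EuclideanSpace ℝ (Fin (n+1))) 1 ↔ splitE n x ∈ S := by
      simp only [S, Set.mem_ofPred_eq, ← splitE_norm, mem_closedBall_zero_iff]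
      rw [sq_le_one_iff₀ (norm_nonneg _)]
    by_cases hx : splitE n x ∈ S
    · rw [Set.indicator_of_mem hx, Set.indicator_of_mem (this.2 hx)]; rfl
    · rw [Set.indicator_of_notMem hx, Set.indicator_of_notMem (fun h => hx (this.1 h))]
  have hSsub : S ⊆ Metric.closedBall 0 1 ×ˢ Metric.closedBall 0 1 := by
    intro z hz
    have hz : z.1^2 + ‖z.2‖^2 ≤ 1 := hz
    simp only [Set.mem_prod, mem_closedBall_zero_iff, Real.norm_eq_abs]
    constructor
    · rw [← sq_le_one_iff₀ (abs_nonneg _), sq_abs]; nlinarith [sq_nonneg ‖z.2‖]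
    · rw [← sq_le_one_iff₀ (norm_nonneg _)]; nlinarith [sq_nonneg z.1]
  have hcomp : IsCompact S := ((isCompact_closedBall _ _).prod (isCompact_closedBall _ _)).of_isClosed_subset hScl hSsub
  have hInteg : IntegrableOn (fun z : ℝ × EuclideanSpace ℝ (Fin n) => g z.1) S :=
    (by fun_prop : Continuous fun z : ℝ × EuclideanSpace ℝ (Fin n) => g z.1).continuousOn.integrableOn_compact hcomp
  rw [h1, ← integral_indicator hS]
  rw [show (volume : Measure (ℝ × EuclideanSpace ℝ (Fin n))) = volume.prod volume from rfl,
    integral_prod _ (by rw [integrable_indicator_iff hS]; exact hInteg)]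
  rw [intervalIntegral.integral_of_le (by norm_num), ← integral_Icc_eq_integral_Ioc,
    ← integral_const_mul, ← integral_indicator measurableSet_Icc]
  congr 1; ext t
  by_cases ht : t ∈ Set.Icc (-1:ℝ) 1
  · rw [Set.indicator_of_mem ht]
    have h0 : 0 ≤ 1 - t^2 := by nlinarith [ht.1, ht.2]
    have : (fun y => S.indicator (fun z : ℝ × EuclideanSpace ℝ (Fin n) => g z.1) (t, y)) =
       (Metric.closedBall (0 : EuclideanSpace ℝ (Fin n)) (Real.sqrt (1 - t^2))).indicator (fun _ => g t) := by
      ext y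
      have : (t, y) ∈ S ↔ y ∈ Metric.closedBall (0 : EuclideanSpace ℝ (Fin n)) (Real.sqrt (1 - t^2)) := by
        simp only [S, Set.mem_ofPred_eq, mem_closedBall_zero_iff]
        rw [Real.le_sqrt (norm_nonneg _) h0]
        constructor <;> intro h <;> linarith
      by_cases hx : (t,y) ∈ S
      · rw [Set.indicator_of_mem hx, Set.indicator_of_mem (this.1 hx)]
      · rw [Set.indicator_of_notMem hx, Set.indicator_of_notMem (fun h => hx (this.2 h))]
    rw [this, integral_indicator Metric.isClosed_closedBall.measurableSet, setIntegral_const,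
      Measure.real, Measure.addHaar_closedBall' _ _ (Real.sqrt_nonneg _), ENNReal.toReal_mul, ENNReal.toReal_ofReal (by positivity)]
    have e : Real.sqrt (1 - t^2) ^ (Module.finrank ℝ (EuclideanSpace ℝ (Fin n))) = (1 - t^2) ^ ((n:ℝ)/2) := by
      rw [finrank_euclideanSpace_fin, Real.sqrt_eq_rpow, ← Real.rpow_natCast, ← Real.rpow_mul h0]
      congr 1; ring
    rw [e, Complex.real_smul, Measure.real]; push_cast; ring
  · rw [Set.indicator_of_notMem ht]
    have : (fun y => S.indicator (fun z : ℝ × EuclideanSpace ℝ (Fin n) => g z.1) (t, y)) = 0 := by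
      ext y
      rw [Set.indicator_of_notMem]; · rfl
      intro h
      have := (hSsub h).1
      simp only [mem_closedBall_zero_iff, Real.norm_eq_abs, abs_le] at this
      exact ht this
    rw [this]; simp

lemma slice_exp (n : ℕ) : ∃ C, 0 ≤ C ∧ ∀ l : ℝ, 0 < l →
    ‖∫ x in Metric.closedBall (0 : EuclideanSpace ℝ (Fin (n+1))) 1, Complex.exp (-(l * x 0 : ℝ) * Complex.I)‖
      ≤ C * l ^ (-((n:ℝ)/2+1)) := by
  obtain ⟨C, hC, h⟩ := besJ_bound ((n:ℝ)/2) (by positivity)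
  refine ⟨volume.real (Metric.closedBall (0 : EuclideanSpace ℝ (Fin n)) 1) * C, by positivity, fun l hl => ?_⟩
  rw [slice_int n (fun t => Complex.exp (-(l * t : ℝ) * Complex.I)) (by fun_prop)]
  have hc := contBes ((n:ℝ)/2) (by positivity)
  have hcc : Continuous (fun t : ℝ => (((1 - t^2) ^ ((n:ℝ)/2) : ℝ) : ℂ)) := Complex.continuous_ofReal.comp hc
  have key : ∫ t in (-1:ℝ)..1, (((1 - t^2) ^ ((n:ℝ)/2) : ℝ) : ℂ) * Complex.exp (-(l * t : ℝ) * Complex.I)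
      = (besJ ((n:ℝ)/2) l : ℂ) := by
    have e : ∀ t : ℝ, (((1 - t^2) ^ ((n:ℝ)/2) : ℝ) : ℂ) * Complex.exp (-(l * t : ℝ) * Complex.I)
      = (((1 - t^2) ^ ((n:ℝ)/2) * Real.cos (l * t) : ℝ) : ℂ) -
        (((1 - t^2) ^ ((n:ℝ)/2) * Real.sin (l * t) : ℝ) : ℂ) * Complex.I := by
      intro t
      rw [← Complex.ofReal_neg, Complex.exp_mul_I, ← Complex.ofReal_cos, ← Complex.ofReal_sin, Real.cos_neg, Real.sin_neg]
      push_cast; ring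
    simp_rw [e]
    rw [intervalIntegral.integral_sub, intervalIntegral.integral_mul_const,
      intervalIntegral.integral_ofReal, intervalIntegral.integral_ofReal]
    · have hodd : ∫ t in (-1:ℝ)..1, (1 - t^2) ^ ((n:ℝ)/2) * Real.sin (l * t) = 0 := by
        have := intervalIntegral.integral_comp_neg (a := -1) (b := 1) (fun t : ℝ => (1 - t^2) ^ ((n:ℝ)/2) * Real.sin (l * t))
        simp only [neg_neg, even_two, Even.neg_pow, mul_neg, Real.sin_neg, intervalIntegral.integral_neg] at this
        linarith
      rw [hodd]; simp [besJ]
    · exact (by fun_prop : Continuous _).intervalIntegrable _ _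
    · exact (by fun_prop : Continuous _).intervalIntegrable _ _
  rw [key, norm_mul, Complex.norm_real, Complex.norm_real, Real.norm_of_nonneg (by positivity), mul_assoc]
  gcongr
  exact h l hl

lemma ball_fourier (d : ℕ) (hd : 1 ≤ d) : ∃ C, 0 ≤ C ∧ ∀ (ξ y : EuclideanSpace ℝ (Fin d)) (r : ℝ), ξ ≠ 0 → 0 < r →
    ‖∫ x in Metric.closedBall y r, Complex.exp (-(2 * Real.pi * inner ℝ ξ x : ℝ) * Complex.I)‖^2
      ≤ C * r ^ (d - 1) * ‖ξ‖ ^ (-((d:ℝ)+1)) := by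
  obtain ⟨n, rfl⟩ : ∃ n, d = n + 1 := ⟨d - 1, by omega⟩
  obtain ⟨C, hC, h⟩ := slice_exp n
  refine ⟨(C * (2*Real.pi) ^ (-((n:ℝ)/2+1)))^2, by positivity, fun ξ y r hξ hr => ?_⟩
  have hξ' : 0 < ‖ξ‖ := norm_pos_iff.2 hξ
  -- rotation
  obtain ⟨b, hb⟩ : ∃ b : OrthonormalBasis (Fin (n+1)) ℝ (EuclideanSpace ℝ (Fin (n+1))), b 0 = ‖ξ‖⁻¹ • ξ := by
    have := Orthonormal.exists_orthonormalBasis_extension_of_card_eq (𝕜 := ℝ)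
      (E := EuclideanSpace ℝ (Fin (n+1))) (ι := Fin (n+1)) (by simp) (v := fun _ => ‖ξ‖⁻¹ • ξ) (s := {0}) ?_
    · obtain ⟨b, hb⟩ := this
      exact ⟨b, hb 0 rfl⟩
    · rw [orthonormal_iff_ite]
      rintro ⟨i, hi⟩ ⟨j, hj⟩
      simp only [Set.mem_singleton_iff] at hi hj
      subst hi; subst hj
      simp only [if_true]
      rw [real_inner_self_eq_norm_sq, show ({0} : Set (Fin (n+1))).domRestrict (fun _ => ‖ξ‖⁻¹ • ξ) ⟨0, hi⟩ = ‖ξ‖⁻¹ • ξ from rfl, norm_smul, norm_inv, norm_norm, inv_mul_cancel₀ hξ'.ne']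
      norm_num
  have hin : ∀ z, inner ℝ ξ (b.repr.symm z) = ‖ξ‖ * z 0 := by
    intro z
    have h1 : ξ = ‖ξ‖ • b 0 := by rw [hb, smul_smul, mul_inv_cancel₀ hξ'.ne', one_smul]
    nth_rewrite 1 [h1]
    rw [inner_smul_left, ← b.repr_apply_apply]; simp
  have e0 : ∫ x in Metric.closedBall y r, Complex.exp (-(2 * Real.pi * inner ℝ ξ x : ℝ) * Complex.I)
     = Complex.exp (-(2 * Real.pi * inner ℝ ξ y : ℝ) * Complex.I) *
       ∫ x in Metric.closedBall (0 : EuclideanSpace ℝ (Fin (n+1))) r, Complex.exp (-(2 * Real.pi * inner ℝ ξ x : ℝ) * Complex.I) := by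
    rw [← integral_const_mul, ← integral_indicator Metric.isClosed_closedBall.measurableSet,
      ← integral_indicator Metric.isClosed_closedBall.measurableSet,
      ← integral_add_left_eq_self _ y]
    congr 1; ext x
    have : y + x ∈ Metric.closedBall y r ↔ x ∈ Metric.closedBall (0 : EuclideanSpace ℝ (Fin (n+1))) r := by simp
    by_cases hx : x ∈ Metric.closedBall (0 : EuclideanSpace ℝ (Fin (n+1))) r
    · rw [Set.indicator_of_mem hx, Set.indicator_of_mem (this.2 hx), ← Complex.exp_add, inner_add_right]
      congr 1; push_cast; ring
    · rw [Set.indicator_of_notMem hx, Set.indicator_of_notMem (fun h => hx (this.1 h))]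
  have e1 : ∫ x in Metric.closedBall (0 : EuclideanSpace ℝ (Fin (n+1))) r, Complex.exp (-(2 * Real.pi * inner ℝ ξ x : ℝ) * Complex.I)
     = (r^(n+1) : ℝ) • ∫ x in Metric.closedBall (0 : EuclideanSpace ℝ (Fin (n+1))) 1, Complex.exp (-(2 * Real.pi * r * inner ℝ ξ x : ℝ) * Complex.I) := by
    have := Measure.setIntegral_comp_smul (μ := (volume : Measure (EuclideanSpace ℝ (Fin (n+1)))))
      (fun x => Complex.exp (-(2 * Real.pi * inner ℝ ξ x : ℝ) * Complex.I)) (R := r)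
      (Metric.closedBall (0 : EuclideanSpace ℝ (Fin (n+1))) 1) hr.ne'
    rw [smul_closedBall _ _ zero_le_one] at this
    simp only [smul_zero, mul_one, Real.norm_eq_abs, abs_of_pos hr, finrank_euclideanSpace_fin] at this
    have e : ∀ x, (2 * Real.pi * r * inner ℝ ξ x : ℝ) = 2 * Real.pi * inner ℝ ξ (r • x) := by
      intro x; rw [inner_smul_right]; ring
    simp_rw [e]
    rw [this, abs_of_pos (by positivity), smul_smul, mul_inv_cancel₀ (by positivity), one_smul]
  have e2 : ∫ x in Metric.closedBall (0 : EuclideanSpace ℝ (Fin (n+1))) 1, Complex.exp (-(2 * Real.pi * r * inner ℝ ξ x : ℝ) * Complex.I)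
     = ∫ x in Metric.closedBall (0 : EuclideanSpace ℝ (Fin (n+1))) 1, Complex.exp (-((2 * Real.pi * r * ‖ξ‖) * x 0 : ℝ) * Complex.I) := by
    have hmp := b.repr.symm.measurePreserving
    have hs : b.repr.symm ⁻¹' (Metric.closedBall (0 : EuclideanSpace ℝ (Fin (n+1))) 1) = Metric.closedBall (0 : EuclideanSpace ℝ (Fin (n+1))) 1 := by
      ext x; simp
    have := hmp.setIntegral_preimage_emb b.repr.symm.toHomeomorph.measurableEmbedding
      (fun x => Complex.exp (-(2 * Real.pi * r * inner ℝ ξ x : ℝ) * Complex.I)) (Metric.closedBall 0 1)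
    rw [← this, hs]
    simp only [hin, mul_assoc]
  rw [e0, norm_mul]
  have : ‖Complex.exp (-(2 * Real.pi * inner ℝ ξ y : ℝ) * Complex.I)‖ = 1 := by
    rw [← Complex.ofReal_neg]; exact Complex.norm_exp_ofReal_mul_I _
  rw [this, one_mul, e1, e2, norm_smul, Real.norm_of_nonneg (by positivity)]
  have hb := h (2 * Real.pi * r * ‖ξ‖) (by positivity)
  calc _ ≤ (r^(n+1) * (C * (2 * Real.pi * r * ‖ξ‖) ^ (-((n:ℝ)/2+1))))^2 := by gcongr
    _ = (C * (2*Real.pi) ^ (-((n:ℝ)/2+1)))^2 * (r^(n+1) * r ^ (-((n:ℝ)/2+1)))^2 * (‖ξ‖ ^ (-((n:ℝ)/2+1)))^2 := by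
      rw [Real.mul_rpow (by positivity) (by positivity), Real.mul_rpow (by positivity) (by positivity)]; ring
    _ = _ := by
      congr 1
      · congr 1
        rw [← Real.rpow_natCast r (n+1), ← Real.rpow_add hr, ← Real.rpow_natCast _ 2, ← Real.rpow_mul hr.le, ← Real.rpow_natCast]
        congr 1
        push_cast
        ring
      · rw [← Real.rpow_natCast _ 2, ← Real.rpow_mul hξ'.le]
        congr 1; push_cast; ring


/-- Lattice point with integer coordinates `m` in the basis `b`. -/
def latPt {d : ℕ} (b : Module.Basis (Fin d) ℝ (EuclideanSpace ℝ (Fin d))) (m : Fin d → ℤ) :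
    EuclideanSpace ℝ (Fin d) := ∑ i, (m i : ℝ) • b i

/-- Fundamental domain. -/
def fdom {d : ℕ} (b : Module.Basis (Fin d) ℝ (EuclideanSpace ℝ (Fin d))) :
    Set (EuclideanSpace ℝ (Fin d)) := {x | ∀ i, b.repr x i ∈ Set.Ico (0:ℝ) 1}

section
variable {d : ℕ} (b : Module.Basis (Fin d) ℝ (EuclideanSpace ℝ (Fin d)))

lemma latPt_repr (m : Fin d → ℤ) (i : Fin d) : b.repr (latPt b m) i = m i := by
  unfold latPt
  rw [Module.Basis.repr_sum_self]

lemma latPt_sub (m n : Fin d → ℤ) : latPt b (m - n) = latPt b m - latPt b n := by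
  unfold latPt
  rw [← Finset.sum_sub_distrib]
  refine Finset.sum_congr rfl fun i _ => ?_
  rw [← sub_smul]; simp

lemma repr_cont (i : Fin d) : Continuous (fun x => b.repr x i) :=
  LinearMap.continuous_of_finiteDimensional (b.coord i)

lemma fdom_meas : MeasurableSet (fdom b) := by
  have : fdom b = ⋂ i, (fun x => b.repr x i) ⁻¹' Set.Ico (0:ℝ) 1 := by
    ext x; simp [fdom]
  rw [this]
  exact MeasurableSet.iInter fun i => (repr_cont b i).measurable measurableSet_Ico

/-- translates of the fundamental domain -/
def cellS (m : Fin d → ℤ) : Set (EuclideanSpace ℝ (Fin d)) := {x | ∀ i, ⌊b.repr x i⌋ = m i}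

lemma cellS_pre (m : Fin d → ℤ) : (fun x => latPt b m + x) ⁻¹' (cellS b m) = fdom b := by
  ext x
  simp only [cellS, Set.mem_preimage, Set.mem_ofPred_eq, fdom]
  refine forall_congr' fun i => ?_
  rw [map_add, Finsupp.add_apply, latPt_repr, Int.floor_intCast_add]
  rw [add_eq_left, Int.floor_eq_zero_iff]

lemma cellS_meas (m : Fin d → ℤ) : MeasurableSet (cellS b m) := by
  have : cellS b m = ⋂ i, (fun x => ⌊b.repr x i⌋) ⁻¹' {m i} := by
    ext x; simp [cellS]
  rw [this]
  exact MeasurableSet.iInter fun i =>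
    (Int.measurable_floor.comp (repr_cont b i).measurable) (measurableSet_singleton _)

lemma cellS_disj : Pairwise (Function.onFun Disjoint (cellS b)) := by
  intro m n hmn
  refine Set.disjoint_left.2 fun x hx hy => hmn ?_
  ext i; rw [← hx i, ← hy i]

lemma cellS_union : ⋃ m, cellS b m = Set.univ := by
  ext x; simp only [Set.mem_iUnion, Set.mem_univ, iff_true]
  exact ⟨fun i => ⌊b.repr x i⌋, fun i => rfl⟩

lemma unfold_lint (h : EuclideanSpace ℝ (Fin d) → ENNReal) (hh : Measurable h) :
    ∫⁻ u in fdom b, ∑' m, h (latPt b m + u) = ∫⁻ x, h x := by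
  rw [lintegral_tsum (f := fun m u => h (latPt b m + u)) (fun m => (hh.comp (measurable_const_add _)).aemeasurable)]
  rw [← setLIntegral_univ h, ← cellS_union b, lintegral_iUnion (cellS_meas b) (cellS_disj b)]
  congr 1; ext m
  rw [← (measurePreserving_add_left volume (latPt b m)).setLIntegral_comp_preimage (cellS_meas b m) hh]
  rw [cellS_pre]

lemma unfold_int (h : EuclideanSpace ℝ (Fin d) → ℂ) (hh : Measurable h) (hi : Integrable h) :
    ∫ u in fdom b, ∑' m, h (latPt b m + u) = ∫ x, h x := by
  rw [integral_tsum (f := fun m u => h (latPt b m + u)) (fun m => (hh.comp (measurable_const_add _)).aestronglyMeasurable)]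
  · rw [← setIntegral_univ (f := h), ← cellS_union b, integral_iUnion (cellS_meas b) (cellS_disj b) hi.integrableOn]
    congr 1; ext m
    rw [← (measurePreserving_add_left volume (latPt b m)).setIntegral_preimage_emb (measurableEmbedding_addLeft _) h (cellS b m)]
    rw [cellS_pre]
  · rw [← lintegral_tsum (f := fun m u => ‖h (latPt b m + u)‖ₑ) (fun m => (hh.comp (measurable_const_add _)).enorm.aemeasurable)]
    rw [unfold_lint b (fun x => ‖h x‖ₑ) hh.enorm]
    exact hi.2.ne

lemma fdom_bdd : Bornology.IsBounded (fdom b) := by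
  have := ZSpan.fundamentalDomain_isBounded b
  exact this

lemma fdom_ne_top : volume (fdom b) ≠ ⊤ := (fdom_bdd b).measure_lt_top.ne

lemma fdom_ne_zero : volume (fdom b) ≠ 0 := ZSpan.measure_fundamentalDomain_ne_zero b

lemma fdom_pos : 0 < volume.real (fdom b) := ENNReal.toReal_pos (fdom_ne_zero b) (fdom_ne_top b)

/-- number of lattice points in a translated ball -/
lemma count_bound : ∃ κ : ℝ, 0 ≤ κ ∧ ∀ (y u : EuclideanSpace ℝ (Fin d)) (R : ℝ), 0 ≤ R →
    ∑' m, (Metric.closedBall y R).indicator (fun _ => (1:ENNReal)) (latPt b m + u) ≤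
      ENNReal.ofReal ((κ * R + 1) ^ d) := by
  have hk : ∃ κ : ℝ, 0 ≤ κ ∧ ∀ i x, |b.repr x i| ≤ κ * ‖x‖ := by
    have hi : ∀ i, ∃ K : ℝ, 0 ≤ K ∧ ∀ x, |b.repr x i| ≤ K * ‖x‖ := fun i =>
      ⟨‖LinearMap.toContinuousLinearMap (b.coord i)‖, norm_nonneg _, fun x =>
        (LinearMap.toContinuousLinearMap (b.coord i)).le_opNorm x⟩
    choose K hK hK2 using hi
    refine ⟨∑ i, K i, Finset.sum_nonneg fun i _ => hK i, fun i x => (hK2 i x).trans ?_⟩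
    gcongr
    exact Finset.single_le_sum (f := K) (fun i _ => hK i) (Finset.mem_univ i)
  obtain ⟨κ, hκ, h⟩ := hk
  refine ⟨2 * κ, by positivity, fun y u R hR => ?_⟩
  let c : Fin d → ℝ := fun i => b.repr (y - u) i
  let F : Finset (Fin d → ℤ) := Fintype.piFinset fun i => Finset.Icc ⌈c i - κ * R⌉ ⌊c i + κ * R⌋
  have hF : ∀ m ∉ F, (Metric.closedBall y R).indicator (fun _ => (1:ENNReal)) (latPt b m + u) = 0 := by
    intro m hm
    refine Set.indicator_of_notMem (fun hmem => hm ?_) _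
    rw [Fintype.mem_piFinset]
    intro i
    rw [mem_closedBall_iff_norm] at hmem
    have h1 := h i (latPt b m - (y - u))
    have h2 : latPt b m - (y - u) = latPt b m + u - y := by abel
    rw [map_sub, Finsupp.sub_apply, latPt_repr, h2] at h1
    have h3 : |(m i : ℝ) - c i| ≤ κ * R := h1.trans (by gcongr)
    rw [abs_le] at h3
    rw [Finset.mem_Icc, Int.ceil_le, Int.le_floor]
    constructor <;> linarith
  rw [tsum_eq_sum hF]
  calc _ ≤ ∑ m ∈ F, (1:ENNReal) := Finset.sum_le_sum fun m _ => Set.indicator_le_self' (fun _ _ => zero_le_one) _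
    _ = (F.card : ENNReal) := by simp
    _ = ENNReal.ofReal (F.card : ℝ) := by rw [ENNReal.ofReal_natCast]
    _ ≤ _ := by
      apply ENNReal.ofReal_le_ofReal
      rw [Fintype.card_piFinset, Nat.cast_prod]
      calc _ ≤ ∏ i : Fin d, (2 * κ * R + 1) := by
            refine Finset.prod_le_prod (fun _ _ => by positivity) fun i _ => ?_
            rw [Int.card_Icc]
            have h1 := Int.floor_le (c i + κ * R)
            have h2 := Int.le_ceil (c i - κ * R)
            have : (((⌊c i + κ * R⌋ + 1 - ⌈c i - κ * R⌉).toNat : ℤ) : ℝ) ≤ 2 * κ * R + 1 := by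
              rw [Int.toNat_eq_max]
              push_cast
              refine max_le (by linarith) (by positivity)
            exact_mod_cast this
        _ = _ := by simp
end


section parseval

local instance torusMS : MeasureSpace UnitAddCircle := ⟨AddCircle.haarAddCircle⟩

local instance torusHaar : Measure.IsAddHaarMeasure (volume : Measure UnitAddCircle) :=
  inferInstanceAs (Measure.IsAddHaarMeasure AddCircle.haarAddCircle)

local instance torusProb : IsProbabilityMeasure (volume : Measure UnitAddCircle) :=
  inferInstanceAs (IsProbabilityMeasure AddCircle.haarAddCircle)

lemma parseval_cube {d : ℕ} (G : (Fin d → ℝ) → ℂ) (hG : Measurable G) (K : ℝ)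
    (hK : ∀ x, ‖G x‖ ≤ K) :
    HasSum (fun k : Fin d → ℤ => ‖∫ x in {x : Fin d → ℝ | ∀ i, x i ∈ Set.Ioc (0:ℝ) 1},
      Complex.exp (-(2 * Real.pi * ∑ i, (k i : ℝ) * x i : ℝ) * Complex.I) * G x‖ ^ 2)
      (∫ x in {x : Fin d → ℝ | ∀ i, x i ∈ Set.Ioc (0:ℝ) 1}, ‖G x‖ ^ 2) := by
  let e : UnitAddTorus (Fin d) → (Fin d → ℝ) := fun x i => (AddCircle.measurableEquivIoc 1 0 (x i)).1
  have he : Measurable e := by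
    refine measurable_pi_lambda _ fun i => ?_
    exact measurable_subtype_coe.comp ((AddCircle.measurableEquivIoc 1 0).measurable.comp (measurable_pi_apply i))
  have hee : ∀ x : Fin d → ℝ, (∀ i, x i ∈ Set.Ioc (0:ℝ) (0+1)) → e (fun i => (x i : UnitAddCircle)) = x := by
    intro x hx
    ext i
    exact (toIocMod_eq_self (zero_lt_one)).2 (hx i)
  have hcube : {x : Fin d → ℝ | ∀ i, x i ∈ Set.Ioc ((fun _ => (0:ℝ)) i) ((fun _ => (0:ℝ)) i + 1)} = {x : Fin d → ℝ | ∀ i, x i ∈ Set.Ioc (0:ℝ) 1} := by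
    simp
  have hmc : MeasurableSet {x : Fin d → ℝ | ∀ i, x i ∈ Set.Ioc (0:ℝ) 1} :=
    MeasurableSet.univ_pi' (fun i => measurableSet_Ioc)
  have hmem : MemLp (fun x => G (e x)) 2 (volume : Measure (UnitAddTorus (Fin d))) :=
    MemLp.of_bound (hG.comp he).aestronglyMeasurable K (ae_of_all _ fun x => hK _)
  have h := UnitAddTorus.hasSum_sq_mFourierCoeff (hmem.toLp _)
  have h1 : ∫ t, ‖(hmem.toLp _) t‖ ^ 2 = ∫ x in {x : Fin d → ℝ | ∀ i, x i ∈ Set.Ioc (0:ℝ) 1}, ‖G x‖ ^ 2 := by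
    rw [integral_congr_ae (g := fun t => ‖G (e t)‖^2)]
    · rw [UnitAddTorus.integral_preimage _ (fun _ => 0), hcube]
      refine setIntegral_congr_fun hmc fun x hx => ?_
      rw [hee x (by simpa using hx)]
    · filter_upwards [hmem.coeFn_toLp] with t ht
      rw [ht]
  have h2 : ∀ k, UnitAddTorus.mFourierCoeff (hmem.toLp _) k = ∫ x in {x : Fin d → ℝ | ∀ i, x i ∈ Set.Ioc (0:ℝ) 1},
      Complex.exp (-(2 * Real.pi * ∑ i, (k i : ℝ) * x i : ℝ) * Complex.I) * G x := by
    intro k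
    have : UnitAddTorus.mFourierCoeff (hmem.toLp _) k = UnitAddTorus.mFourierCoeff (fun t => G (e t)) k := by
      unfold UnitAddTorus.mFourierCoeff
      refine integral_congr_ae ?_
      filter_upwards [hmem.coeFn_toLp] with t ht
      rw [ht]
    rw [this, UnitAddTorus.mFourierCoeff_eq_integral _ _ (fun _ => 0), hcube]
    refine setIntegral_congr_fun hmc fun x hx => ?_
    rw [hee x (by simpa using hx), smul_eq_mul]
    congr 1
    simp only [UnitAddTorus.mFourier, ContinuousMap.coe_mk, Pi.neg_apply, fourier_coe_apply]
    rw [← Complex.exp_sum]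
    congr 1
    push_cast
    rw [Finset.mul_sum, ← Finset.sum_neg_distrib, Finset.sum_mul]
    refine Finset.sum_congr rfl fun i _ => ?_
    ring
  rw [h1] at h
  simpa only [h2] using h
end parseval


section
variable {d : ℕ} (b : Module.Basis (Fin d) ℝ (EuclideanSpace ℝ (Fin d)))

lemma cube_to_fdom {X : Type*} [NormedAddCommGroup X] [NormedSpace ℝ X]
    (F : EuclideanSpace ℝ (Fin d) → X) :
    ∫ x in {x : Fin d → ℝ | ∀ i, x i ∈ Set.Ioc (0:ℝ) 1}, F (b.equivFun.symm x) =
      (volume.real (fdom b))⁻¹ • ∫ u in fdom b, F u := by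
  let T : (Fin d → ℝ) ≃L[ℝ] EuclideanSpace ℝ (Fin d) := b.equivFun.symm.toContinuousLinearEquiv
  have hTm : MeasurableEmbedding T := T.toHomeomorph.measurableEmbedding
  have hae : ({x : Fin d → ℝ | ∀ i, x i ∈ Set.Ioc (0:ℝ) 1} : Set (Fin d → ℝ)) =ᵐ[volume]
      {x : Fin d → ℝ | ∀ i, x i ∈ Set.Ico (0:ℝ) 1} := by
    have e1 := Measure.univ_pi_Ico_ae_eq_Icc (μ := fun _ : Fin d => (volume : Measure ℝ)) (f := fun _ => (0:ℝ)) (g := fun _ => (1:ℝ))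
    have e2 := Measure.univ_pi_Ioc_ae_eq_Icc (μ := fun _ : Fin d => (volume : Measure ℝ)) (f := fun _ => (0:ℝ)) (g := fun _ => (1:ℝ))
    have := e2.trans e1.symm
    have s1 : ({x : Fin d → ℝ | ∀ i, x i ∈ Set.Ioc (0:ℝ) 1}) = Set.univ.pi (fun _ => Set.Ioc (0:ℝ) 1) := by
      ext; simp
    have s2 : ({x : Fin d → ℝ | ∀ i, x i ∈ Set.Ico (0:ℝ) 1}) = Set.univ.pi (fun _ => Set.Ico (0:ℝ) 1) := by
      ext; simp
    rw [s1, s2]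
    exact this
  have hpre : T ⁻¹' (fdom b) = {x : Fin d → ℝ | ∀ i, x i ∈ Set.Ico (0:ℝ) 1} := by
    ext x
    simp only [fdom, Set.mem_preimage, Set.mem_ofPred_eq]
    refine forall_congr' fun i => ?_
    have : b.repr (T x) i = x i := by
      change b.equivFun (b.equivFun.symm x) i = x i
      rw [LinearEquiv.apply_symm_apply]
    rw [this]
  have hcube : volume ({x : Fin d → ℝ | ∀ i, x i ∈ Set.Ico (0:ℝ) 1}) = 1 := by
    have : ({x : Fin d → ℝ | ∀ i, x i ∈ Set.Ico (0:ℝ) 1}) = Set.univ.pi (fun _ => Set.Ico (0:ℝ) 1) := by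
      ext; simp
    rw [this, volume_pi, Measure.pi_pi]; simp
  have hH : (Measure.map T volume).IsAddHaarMeasure := T.isAddHaarMeasure_map volume
  have hmap := Measure.isAddLeftInvariant_eq_smul (Measure.map T volume) (volume : Measure (EuclideanSpace ℝ (Fin d)))
  set c := Measure.addHaarScalarFactor (Measure.map T volume) (volume : Measure (EuclideanSpace ℝ (Fin d)))
  have hc : (c : ℝ) * volume.real (fdom b) = 1 := by
    have h1 : Measure.map T volume (fdom b) = 1 := by rw [hTm.map_apply, hpre, hcube]
    rw [hmap] at h1
    rw [Measure.smul_apply] at h1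
    have := congrArg ENNReal.toReal h1
    simpa [ENNReal.smul_def, Measure.real] using this
  have hc' : (volume.real (fdom b))⁻¹ = c := by
    rw [inv_eq_one_div, div_eq_iff (fdom_pos b).ne', hc]
  rw [setIntegral_congr_set hae, ← hpre, hc']
  change ∫ x in T ⁻¹' (fdom b), F (T x) = _
  rw [← hTm.setIntegral_map, hmap, Measure.restrict_smul, integral_smul_nnreal_measure]
  rfl

/-- dual vector -/
def dualV (k : Fin d → ℤ) : EuclideanSpace ℝ (Fin d) :=
  (InnerProductSpace.toDual ℝ _).symm (LinearMap.toContinuousLinearMap (∑ i, (k i : ℝ) • b.coord i))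

lemma dualV_inner (k : Fin d → ℤ) (x : EuclideanSpace ℝ (Fin d)) :
    inner ℝ (dualV b k) x = ∑ i, (k i : ℝ) * b.repr x i := by
  unfold dualV
  rw [InnerProductSpace.toDual_symm_apply]
  simp

/-- number of lattice points `latPt b m + u` in the ball, as extended nonnegative real -/
def cntE (y : EuclideanSpace ℝ (Fin d)) (r : ℝ) (u : EuclideanSpace ℝ (Fin d)) : ENNReal :=
  ∑' m, (Metric.closedBall y r).indicator (fun _ => (1:ENNReal)) (latPt b m + u)

lemma cntE_meas (y : EuclideanSpace ℝ (Fin d)) (r : ℝ) : Measurable (cntE b y r) :=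
  Measurable.tsum fun m => (measurable_const.indicator Metric.isClosed_closedBall.measurableSet).comp
    (measurable_const_add _)

lemma exp_shift (k m : Fin d → ℤ) (u : EuclideanSpace ℝ (Fin d)) :
    Complex.exp (-(2 * Real.pi * inner ℝ (dualV b k) (latPt b m + u) : ℝ) * Complex.I) =
    Complex.exp (-(2 * Real.pi * inner ℝ (dualV b k) u : ℝ) * Complex.I) := by
  rw [inner_add_right, dualV_inner b k (latPt b m)]
  simp only [latPt_repr]
  have : (∑ i, (k i : ℝ) * (m i : ℝ)) = ((∑ i, k i * m i : ℤ) : ℝ) := by push_cast; rfl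
  rw [this]
  rw [Complex.exp_eq_exp_iff_exists_int]
  refine ⟨-(∑ i, k i * m i), ?_⟩
  push_cast
  ring

lemma coef_eq (k : Fin d → ℤ) (y : EuclideanSpace ℝ (Fin d)) (r : ℝ) :
    ∫ u in fdom b, Complex.exp (-(2 * Real.pi * inner ℝ (dualV b k) u : ℝ) * Complex.I) *
      ((cntE b y r u).toReal : ℂ) =
    ∫ x in Metric.closedBall y r, Complex.exp (-(2 * Real.pi * inner ℝ (dualV b k) x : ℝ) * Complex.I) := by
  let φ : EuclideanSpace ℝ (Fin d) → ℂ := fun x => Complex.exp (-(2 * Real.pi * inner ℝ (dualV b k) x : ℝ) * Complex.I)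
  have hφ : Continuous φ := by fun_prop
  have hms : MeasurableSet (Metric.closedBall y r) := Metric.isClosed_closedBall.measurableSet
  rw [← integral_indicator hms, ← unfold_int b _ (hφ.measurable.indicator hms)]
  · refine setIntegral_congr_fun (fdom_meas b) fun u _ => ?_
    simp only [cntE]
    rw [ENNReal.tsum_toReal_eq (fun m => by
      by_cases h : latPt b m + u ∈ Metric.closedBall y r <;> simp [h]), Complex.ofReal_tsum, ← tsum_mul_left]
    refine tsum_congr fun m => ?_
    by_cases h : latPt b m + u ∈ Metric.closedBall y r
    · rw [Set.indicator_of_mem h, Set.indicator_of_mem h]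
      simp only [φ]
      rw [exp_shift]; simp
    · rw [Set.indicator_of_notMem h, Set.indicator_of_notMem h]; simp
  · rw [integrable_indicator_iff hms]
    exact hφ.continuousOn.integrableOn_compact (isCompact_closedBall _ _)

lemma dualV_lower : ∃ K : ℝ, 0 < K ∧ ∀ k : Fin d → ℤ, ‖(fun i => (k i : ℝ))‖ ≤ K * ‖dualV b k‖ := by
  refine ⟨∑ i, ‖b i‖ + 1, by positivity, fun k => ?_⟩
  refine (pi_norm_le_iff_of_nonneg (by positivity)).2 fun i => ?_
  have : (k i : ℝ) = inner ℝ (dualV b k) (b i) := by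
    rw [dualV_inner]
    simp [Finsupp.single_apply]
  rw [this, mul_comm]
  refine (norm_inner_le_norm _ _).trans ?_
  gcongr
  have := Finset.single_le_sum (f := fun i => ‖b i‖) (fun i _ => norm_nonneg _) (Finset.mem_univ i)
  linarith

lemma summable_int : Summable (fun k : Fin d → ℤ => ‖(fun i => (k i : ℝ))‖ ^ (-((d:ℝ)+1))) := by
  let L := Submodule.span ℤ (Set.range (Pi.basisFun ℝ (Fin d)))
  have hr : Module.finrank ℤ L = d := by
    rw [ZLattice.rank ℝ L]; simp
  have h := ZLattice.summable_norm_rpow L (-((d:ℝ)+1)) (by rw [hr]; linarith)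
  let j : (Fin d → ℤ) → L := fun k => ⟨fun i => (k i : ℝ), by
    have : (fun i => (k i : ℝ)) = ∑ i, (k i) • Pi.basisFun ℝ (Fin d) i := by
      ext i; simp [Finset.sum_apply, Pi.single_apply]
    rw [this]
    exact Submodule.sum_mem _ fun i _ => Submodule.smul_mem _ _ (Submodule.subset_span ⟨i, rfl⟩)⟩
  have hj : Function.Injective j := by
    intro k l hkl
    ext i
    have : (k i : ℝ) = (l i : ℝ) := congrFun (congrArg Subtype.val hkl) i
    exact_mod_cast this
  have h2 := h.comp_injective hj
  refine h2.congr fun k => ?_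
  rfl

lemma summable_dualV : Summable (fun k : Fin d → ℤ => ‖dualV b k‖ ^ (-((d:ℝ)+1))) := by
  obtain ⟨K, hK, h⟩ := dualV_lower b
  refine Summable.of_nonneg_of_le (fun _ => by positivity) (fun k => ?_) ((summable_int (d := d)).mul_left (K ^ ((d:ℝ)+1)))
  by_cases hk : ‖(fun i => (k i : ℝ))‖ = 0
  · have : k = 0 := by
      have := norm_eq_zero.1 hk
      ext i
      have h3 : (k i : ℝ) = 0 := congrFun this i
      exact_mod_cast h3
    subst this
    have h0 : dualV b 0 = 0 := by
      rw [← inner_self_eq_zero (𝕜 := ℝ), dualV_inner]; simp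
    rw [h0, norm_zero, Real.zero_rpow (by linarith [Nat.cast_nonneg (α := ℝ) d])]
    positivity
  · have hp : 0 < ‖(fun i => (k i : ℝ))‖ := lt_of_le_of_ne (norm_nonneg _) (Ne.symm hk)
    have hq : ‖(fun i => (k i : ℝ))‖ / K ≤ ‖dualV b k‖ := by rw [div_le_iff₀ hK, mul_comm]; exact h k
    have := Real.rpow_le_rpow_of_nonpos (z := -((d:ℝ)+1)) (div_pos hp hK) hq (by linarith [Nat.cast_nonneg (α := ℝ) d])
    refine this.trans (le_of_eq ?_)
    rw [Real.div_rpow hp.le hK.le, Real.rpow_neg hK.le, div_inv_eq_mul, mul_comm]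

end


section
variable {d : ℕ} (b : Module.Basis (Fin d) ℝ (EuclideanSpace ℝ (Fin d)))

lemma dualV_zero : dualV b 0 = 0 := by
  rw [← inner_self_eq_zero (𝕜 := ℝ), dualV_inner]; simp

lemma dualV_ne_zero {k : Fin d → ℤ} (hk : k ≠ 0) : dualV b k ≠ 0 := by
  intro h
  obtain ⟨K, hK, h2⟩ := dualV_lower b
  have h3 := h2 k
  rw [h, norm_zero, mul_zero] at h3
  have h4 := norm_eq_zero.1 (le_antisymm h3 (norm_nonneg _))
  refine hk ?_
  ext i
  have h5 : (k i : ℝ) = 0 := congrFun h4 i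
  exact_mod_cast h5

lemma cnt_int (y : EuclideanSpace ℝ (Fin d)) (r : ℝ) :
    ∫ u in fdom b, (cntE b y r u).toReal = volume.real (Metric.closedBall y r) := by
  have h := coef_eq b 0 y r
  rw [dualV_zero] at h
  simp only [inner_zero_left, mul_zero, Complex.ofReal_zero, neg_zero, zero_mul, Complex.exp_zero, one_mul] at h
  rw [integral_complex_ofReal] at h
  rw [setIntegral_const] at h
  have h2 : (((∫ u in fdom b, (cntE b y r u).toReal) : ℝ) : ℂ) = ((volume.real (Metric.closedBall y r) : ℝ) : ℂ) := by
    rw [h]; simp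
  exact_mod_cast h2

lemma cnt_bdd : ∃ κ : ℝ, 0 ≤ κ ∧ ∀ (y u : EuclideanSpace ℝ (Fin d)) (r : ℝ), 0 ≤ r →
    cntE b y r u ≤ ENNReal.ofReal ((κ * r + 1) ^ d) ∧ (cntE b y r u).toReal ≤ (κ * r + 1) ^ d := by
  obtain ⟨κ, hκ, h⟩ := count_bound b
  refine ⟨κ, hκ, fun y u r hr => ⟨h y u r hr, ?_⟩⟩
  exact ENNReal.toReal_le_of_le_ofReal (by positivity) (h y u r hr)

lemma lattice_var (hd : 1 ≤ d) : ∃ C : ℝ, 0 ≤ C ∧ ∀ (y : EuclideanSpace ℝ (Fin d)) (r : ℝ), 0 < r →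
    ∫ u in fdom b, ((cntE b y r u).toReal - volume.real (Metric.closedBall y r) / volume.real (fdom b)) ^ 2
      ≤ C * r ^ (d - 1) := by
  obtain ⟨C, hC, hball⟩ := ball_fourier d hd
  obtain ⟨κ, hκ, hcnt⟩ := cnt_bdd b
  set v := volume.real (fdom b) with hv
  have hvpos : 0 < v := fdom_pos b
  refine ⟨v * (∑' k : Fin d → ℤ, v⁻¹ ^ 2 * C * ‖dualV b k‖ ^ (-((d:ℝ)+1))), ?_, fun y r hr => ?_⟩
  · exact mul_nonneg hvpos.le (tsum_nonneg fun k => by positivity)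
  set V := volume.real (Metric.closedBall y r) with hV
  set c := V / v with hc
  have hm := cntE_meas b y r
  have hTc : Continuous (b.equivFun.symm) := b.equivFun.symm.toContinuousLinearEquiv.continuous
  have hp := parseval_cube (fun x => ((cntE b y r (b.equivFun.symm x)).toReal : ℂ))
    (Complex.measurable_ofReal.comp (hm.ennreal_toReal.comp hTc.measurable)) ((κ * r + 1) ^ d) (by
      intro x
      rw [Complex.norm_real, Real.norm_of_nonneg ENNReal.toReal_nonneg]
      exact (hcnt y _ r hr.le).2)
  have hR : (∫ x in {x : Fin d → ℝ | ∀ i, x i ∈ Set.Ioc (0:ℝ) 1}, ‖((cntE b y r (b.equivFun.symm x)).toReal : ℂ)‖ ^ 2)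
      = v⁻¹ * ∫ u in fdom b, (cntE b y r u).toReal ^ 2 := by
    rw [← smul_eq_mul, ← cube_to_fdom b (fun u => (cntE b y r u).toReal ^ 2)]
    simp
  have hK : ∀ k : Fin d → ℤ, (∫ x in {x : Fin d → ℝ | ∀ i, x i ∈ Set.Ioc (0:ℝ) 1},
      Complex.exp (-(2 * Real.pi * ∑ i, (k i : ℝ) * x i : ℝ) * Complex.I) * ((cntE b y r (b.equivFun.symm x)).toReal : ℂ)) =
      v⁻¹ • ∫ x in Metric.closedBall y r, Complex.exp (-(2 * Real.pi * inner ℝ (dualV b k) x : ℝ) * Complex.I) := by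
    intro k
    rw [← coef_eq, ← cube_to_fdom b]
    congr 1; ext x
    rw [dualV_inner]
    have : ∀ i, b.repr (b.equivFun.symm x) i = x i := by
      intro i
      change b.equivFun (b.equivFun.symm x) i = x i
      rw [LinearEquiv.apply_symm_apply]
    simp only [this]
  rw [hR] at hp
  simp only [hK] at hp
  have hsub := hp.sub (hasSum_ite_eq (0 : Fin d → ℤ) (c ^ 2))
  have hsum : Summable (fun k : Fin d → ℤ => (v⁻¹ ^ 2 * C * ‖dualV b k‖ ^ (-((d:ℝ)+1))) * r ^ (d - 1)) :=
    ((summable_dualV b).mul_left _).mul_right _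
  have hle : v⁻¹ * (∫ u in fdom b, (cntE b y r u).toReal ^ 2) - c ^ 2 ≤
      (∑' k : Fin d → ℤ, v⁻¹ ^ 2 * C * ‖dualV b k‖ ^ (-((d:ℝ)+1))) * r ^ (d - 1) := by
    rw [← tsum_mul_right]
    refine hasSum_le (fun k => ?_) hsub hsum.hasSum
    by_cases hk : k = 0
    · subst hk
      have h0 : ‖v⁻¹ • ∫ x in Metric.closedBall y r, Complex.exp (-(2 * Real.pi * inner ℝ (dualV b 0) x : ℝ) * Complex.I)‖ = c := by
        rw [dualV_zero]
        simp only [inner_zero_left, mul_zero, Complex.ofReal_zero, neg_zero, zero_mul, Complex.exp_zero]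
        rw [setIntegral_const, norm_smul, norm_smul, ← hV]
        have : 0 ≤ V := measureReal_nonneg
        rw [Real.norm_of_nonneg this, Real.norm_of_nonneg (by positivity)]
        simp [hc]; field_simp
      rw [h0]
      simp only [if_true, sub_self]
      positivity
    · simp only [hk, if_false, sub_zero]
      rw [norm_smul, mul_pow, Real.norm_of_nonneg (by positivity)]
      calc _ ≤ v⁻¹ ^ 2 * (C * r ^ (d - 1) * ‖dualV b k‖ ^ (-((d:ℝ)+1))) := by
            gcongr
            exact hball _ _ _ (dualV_ne_zero b hk) hr
        _ = _ := by ring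
  have hfin : IsFiniteMeasure (volume.restrict (fdom b)) := ⟨by
    rw [Measure.restrict_apply_univ]; exact (fdom_ne_top b).lt_top⟩
  have hi2 : Integrable (fun u => (cntE b y r u).toReal ^ 2) (volume.restrict (fdom b)) := by
    refine Integrable.of_bound (hm.ennreal_toReal.pow_const 2).aestronglyMeasurable (((κ * r + 1) ^ d)^2) (ae_of_all _ fun u => ?_)
    rw [Real.norm_of_nonneg (by positivity)]
    gcongr
    exact (hcnt y u r hr.le).2
  have hi1 : Integrable (fun u => (cntE b y r u).toReal) (volume.restrict (fdom b)) := by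
    refine Integrable.of_bound (hm.ennreal_toReal).aestronglyMeasurable (((κ * r + 1) ^ d)) (ae_of_all _ fun u => ?_)
    rw [Real.norm_of_nonneg (by positivity)]
    exact (hcnt y u r hr.le).2
  have hexp : ∫ u in fdom b, ((cntE b y r u).toReal - c) ^ 2 = (∫ u in fdom b, (cntE b y r u).toReal ^ 2) - c ^ 2 * v := by
    have : ∀ u, ((cntE b y r u).toReal - c) ^ 2 = (cntE b y r u).toReal ^ 2 - 2 * c * (cntE b y r u).toReal + c ^ 2 := fun u => by ring
    simp only [this]
    rw [integral_add (f := fun u => (cntE b y r u).toReal ^ 2 - 2 * c * (cntE b y r u).toReal) (g := fun _ => c ^ 2) (hi2.sub (hi1.const_mul _)) (integrable_const _), integral_sub hi2 (hi1.const_mul _), integral_const_mul, cnt_int, setIntegral_const, smul_eq_mul, ← hv, ← hV]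
    have : V = c * v := by rw [hc]; field_simp
    rw [this]; ring
  rw [hexp]
  calc _ = v * (v⁻¹ * (∫ u in fdom b, (cntE b y r u).toReal ^ 2) - c ^ 2) := by field_simp
    _ ≤ v * _ := mul_le_mul_of_nonneg_left hle hvpos.le
    _ = _ := by ring
end


lemma abs_cov_le_one {Ω : Type*} [MeasurableSpace Ω] (P : Measure Ω) [IsProbabilityMeasure P] (A B : Set Ω) :
    |(P A).toReal * (P B).toReal - (P (A ∩ B)).toReal| ≤ 1 := by
  have h1 : (P A).toReal ≤ 1 := measureReal_le_one (μ := P)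
  have h2 : (P B).toReal ≤ 1 := measureReal_le_one (μ := P)
  have h3 : (P (A ∩ B)).toReal ≤ 1 := measureReal_le_one (μ := P)
  have h4 : 0 ≤ (P A).toReal := ENNReal.toReal_nonneg
  have h5 : 0 ≤ (P B).toReal := ENNReal.toReal_nonneg
  have h6 : 0 ≤ (P (A ∩ B)).toReal := ENNReal.toReal_nonneg
  rw [abs_le]; constructor <;> nlinarith

lemma alphaSigma_le_one {Ω : Type*} (m₁ m₂ : MeasurableSpace Ω) [MeasurableSpace Ω] (P : Measure Ω)
    [IsProbabilityMeasure P] : alphaSigma P m₁ m₂ ≤ 1 := by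
  refine Real.sSup_le ?_ zero_le_one
  rintro x ⟨A, B, -, -, rfl⟩
  exact abs_cov_le_one P A B

lemma cov_le_mix {Ω ι F : Type*} [MeasurableSpace Ω] [MeasurableSpace F] {d : ℕ}
    (P : Measure Ω) [IsProbabilityMeasure P] (pos : ι → EuclideanSpace ℝ (Fin d))
    (p : ι → Ω → F) (m n : ι) (S T : Set F) (hS : MeasurableSet S) (hT : MeasurableSet T) :
    |P.real (p m ⁻¹' S) * P.real (p n ⁻¹' T) - P.real (p m ⁻¹' S ∩ p n ⁻¹' T)| ≤
      mixCoef P pos p ‖pos m - pos n‖ := by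
  have h1 : |P.real (p m ⁻¹' S) * P.real (p n ⁻¹' T) - P.real (p m ⁻¹' S ∩ p n ⁻¹' T)| ≤
      alphaSigma P (sigmaGen p (({m} : Finset ι) : Set ι)) (sigmaGen p (({n} : Finset ι) : Set ι)) := by
    refine le_csSup ⟨1, ?_⟩ ⟨p m ⁻¹' S, p n ⁻¹' T, ?_, ?_, rfl⟩
    · rintro x ⟨A, B, -, -, rfl⟩
      exact abs_cov_le_one P A B
    · have : MeasurableSpace.comap (p m) inferInstance ≤ sigmaGen p (({m} : Finset ι) : Set ι) :=
        le_iSup₂_of_le m (by simp) le_rfl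
      exact this _ ⟨S, hS, rfl⟩
    · have : MeasurableSpace.comap (p n) inferInstance ≤ sigmaGen p (({n} : Finset ι) : Set ι) :=
        le_iSup₂_of_le n (by simp) le_rfl
      exact this _ ⟨T, hT, rfl⟩
  refine h1.trans (le_csSup ⟨1, ?_⟩ ⟨{m}, {n}, ?_, rfl⟩)
  · rintro x ⟨A, B, -, rfl⟩
    exact alphaSigma_le_one _ _ P
  · simp

lemma mix_nonneg {Ω ι F : Type*} [MeasurableSpace Ω] [MeasurableSpace F] {d : ℕ}
    (P : Measure Ω) (pos : ι → EuclideanSpace ℝ (Fin d))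
    (p : ι → Ω → F) (x : ℝ) : 0 ≤ mixCoef P pos p x := by
  refine Real.sSup_nonneg ?_
  rintro _ ⟨A, B, -, rfl⟩
  refine Real.sSup_nonneg ?_
  rintro _ ⟨A, B, -, -, rfl⟩
  exact abs_nonneg _

lemma cov_le_left {Ω : Type*} [MeasurableSpace Ω] (P : Measure Ω) [IsProbabilityMeasure P] (A B : Set Ω)
    (hA : MeasurableSet A) :
    |P.real A * P.real B - P.real (A ∩ B)| ≤ P.real A ∧ |P.real A * P.real B - P.real (A ∩ B)| ≤ 1 - P.real A := by
  have h2 : P.real B ≤ 1 := measureReal_le_one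
  have h1 : P.real A ≤ 1 := measureReal_le_one
  have h3 : P.real (A ∩ B) ≤ P.real A := measureReal_mono Set.inter_subset_left
  have h4 : 0 ≤ P.real A := measureReal_nonneg
  have h5 : 0 ≤ P.real B := measureReal_nonneg
  have h6 : 0 ≤ P.real (A ∩ B) := measureReal_nonneg
  have h8 : P.real (A ∩ B) ≤ P.real B := measureReal_mono Set.inter_subset_right
  have h7 : P.real B ≤ P.real (A ∩ B) + (1 - P.real A) := by
    rw [← probReal_compl_eq_one_sub hA]
    refine le_trans (measureReal_mono (s₂ := (A ∩ B) ∪ Aᶜ) ?_) (measureReal_union_le _ _)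
    intro x hx
    by_cases h : x ∈ A
    · exact Or.inl ⟨h, hx⟩
    · exact Or.inr h
  constructor <;> rw [abs_le] <;> constructor <;> nlinarith

lemma min_rpow_bound {x a c s q : ℝ} (hx : 0 ≤ x) (hxa : x ≤ a) (hxc : x ≤ c) (hs : 0 < s) (hq : 0 < q)
    (hsq : 1/s + 1/q = 1) : x ≤ a ^ (1/s) * c ^ (1/q) := by
  rcases hx.eq_or_lt with h | h
  · rw [← h]; have := hx.trans hxa; have := hx.trans hxc; positivity
  calc x = x ^ (1/s) * x ^ (1/q) := by rw [← Real.rpow_add h, hsq, Real.rpow_one]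
    _ ≤ _ := by
      have := hx.trans hxa
      gcongr


lemma tail_bound {d : ℕ} (ν : Measure (EuclideanSpace ℝ (Fin d))) [IsProbabilityMeasure ν] (q : ℝ) (hq : 1 ≤ q)
    (hm : ∫⁻ y, (‖y‖₊ : ENNReal) ^ (2 * q) ∂ν < ⊤) :
    ∃ K : ℝ, 0 ≤ K ∧ ∀ (r : ℝ) (x : EuclideanSpace ℝ (Fin d)), ∃ T : ℝ, 0 ≤ T ∧
      (ν.real {y | x + y ∈ Metric.closedBall 0 r} ≤ T ∨ 1 - ν.real {y | x + y ∈ Metric.closedBall 0 r} ≤ T) ∧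
      T ^ (1/q) ≤ K / (1 + (‖x‖ - r) ^ 2) := by
  have hq0 : 0 < q := by linarith
  set M : ENNReal := ∫⁻ y, ENNReal.ofReal ((1 + ‖y‖ ^ 2) ^ q) ∂ν with hM
  have hMt : M < ⊤ := by
    refine lt_of_le_of_lt (lintegral_mono (g := fun y => ENNReal.ofReal (2 ^ q) * (1 + (‖y‖₊ : ENNReal) ^ (2 * q))) fun y => ?_) ?_
    · simp only
      have h1 : (‖y‖₊ : ENNReal) ^ (2 * q) = ENNReal.ofReal (‖y‖ ^ (2 * q)) := by
        rw [← ENNReal.ofReal_rpow_of_nonneg (norm_nonneg _) (by positivity), ofReal_norm, enorm_eq_nnnorm]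
      rw [h1, ← ENNReal.ofReal_one, ← ENNReal.ofReal_add zero_le_one (by positivity), ← ENNReal.ofReal_mul (by positivity)]
      apply ENNReal.ofReal_le_ofReal
      have h2 : ‖y‖ ^ (2 * q) = (‖y‖ ^ 2) ^ q := by
        rw [Real.rpow_mul (norm_nonneg _)]; norm_num
      rw [h2]
      set z := ‖y‖ ^ 2
      have hz : 0 ≤ z := by positivity
      calc (1 + z) ^ q ≤ (2 * max 1 z) ^ q := by
            refine Real.rpow_le_rpow (by positivity) ?_ hq0.le
            linarith [le_max_left 1 z, le_max_right 1 z]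
        _ = 2 ^ q * (max 1 z) ^ q := Real.mul_rpow (by norm_num) (by positivity)
        _ ≤ 2 ^ q * (1 + z ^ q) := by
            gcongr
            rcases max_cases 1 z with ⟨h, _⟩ | ⟨h, _⟩ <;> rw [h]
            · simp; positivity
            · linarith
    · rw [lintegral_const_mul' _ _ ENNReal.ofReal_ne_top, lintegral_add_left measurable_const]
      · simp only [lintegral_const, measure_univ, mul_one]
        exact ENNReal.mul_lt_top ENNReal.ofReal_lt_top (ENNReal.add_lt_top.2 ⟨ENNReal.one_lt_top, hm⟩)
  have htail : ∀ t : ℝ, 0 ≤ t → ν.real {y | t ≤ ‖y‖} ≤ M.toReal / (1 + t ^ 2) ^ q := by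
    intro t ht
    have hmk := mul_meas_ge_le_lintegral (μ := ν) (f := fun y => ENNReal.ofReal ((1 + ‖y‖ ^ 2) ^ q))
      (by fun_prop) (ENNReal.ofReal ((1 + t ^ 2) ^ q))
    have hsub : {y : EuclideanSpace ℝ (Fin d) | t ≤ ‖y‖} ⊆ {y | ENNReal.ofReal ((1 + t ^ 2) ^ q) ≤ ENNReal.ofReal ((1 + ‖y‖ ^ 2) ^ q)} := by
      intro y hy
      have hy' : t ≤ ‖y‖ := hy
      change ENNReal.ofReal ((1 + t ^ 2) ^ q) ≤ ENNReal.ofReal ((1 + ‖y‖ ^ 2) ^ q)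
      gcongr
    have h2 := (mul_le_mul_right (measure_mono (μ := ν) hsub) (ENNReal.ofReal ((1 + t ^ 2) ^ q))).trans hmk
    have h3 := ENNReal.toReal_mono hMt.ne h2
    rw [ENNReal.toReal_mul, ENNReal.toReal_ofReal (by positivity)] at h3
    rw [le_div_iff₀ (by positivity), mul_comm]
    exact h3
  refine ⟨M.toReal ^ (1/q), by positivity, fun r x => ⟨M.toReal / (1 + (‖x‖ - r) ^ 2) ^ q, by positivity, ?_, ?_⟩⟩
  · rcases le_total r ‖x‖ with h | h
    · left
      refine le_trans (measureReal_mono ?_) (htail (‖x‖ - r) (by linarith))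
      intro y hy
      have hy' : ‖x + y‖ ≤ r := by simpa using hy
      change ‖x‖ - r ≤ ‖y‖
      have := norm_sub_norm_le x (-y)
      rw [norm_neg, sub_neg_eq_add] at this
      linarith
    · right
      have hms : MeasurableSet {y | x + y ∈ Metric.closedBall 0 r} :=
        (measurable_const_add x) Metric.isClosed_closedBall.measurableSet
      rw [← probReal_compl_eq_one_sub hms]
      have e : (‖x‖ - r) ^ 2 = (r - ‖x‖) ^ 2 := by ring
      rw [e]
      refine le_trans (measureReal_mono ?_) (htail (r - ‖x‖) (by linarith))
      intro y hy
      have hy' : r < ‖x + y‖ := by simpa using hy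
      change r - ‖x‖ ≤ ‖y‖
      have := norm_add_le x y
      linarith
  · rw [Real.div_rpow (by positivity) (by positivity), ← Real.rpow_mul (by positivity), mul_one_div_cancel hq0.ne', Real.rpow_one]

lemma finite_cov_sum {Ω ι : Type*} [MeasurableSpace Ω] (P : Measure Ω) [IsProbabilityMeasure P] (A : ι → Set Ω)
    (hA : ∀ m, MeasurableSet (A m)) (F : Finset ι) :
    ∫ ω, (∑ m ∈ F, ((A m).indicator (fun _ => (1:ℝ)) ω - P.real (A m))) ^ 2 ∂P =
      ∑ m ∈ F, ∑ n ∈ F, (P.real (A m ∩ A n) - P.real (A m) * P.real (A n)) := by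
  have hi : ∀ B : Set Ω, MeasurableSet B → Integrable (B.indicator (fun _ => (1:ℝ))) P := fun B hB =>
    (integrable_const _).indicator hB
  have hInteg : ∀ m n ω, ((A m).indicator (fun _ => (1:ℝ)) ω - P.real (A m)) * ((A n).indicator (fun _ => (1:ℝ)) ω - P.real (A n)) =
      (A m ∩ A n).indicator (fun _ => (1:ℝ)) ω - P.real (A n) * (A m).indicator (fun _ => (1:ℝ)) ω
        - P.real (A m) * (A n).indicator (fun _ => (1:ℝ)) ω + P.real (A m) * P.real (A n) := by
    intro m n ω
    have : (A m ∩ A n).indicator (fun _ => (1:ℝ)) ω = (A m).indicator (fun _ => (1:ℝ)) ω * (A n).indicator (fun _ => (1:ℝ)) ω := by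
      by_cases h1 : ω ∈ A m <;> by_cases h2 : ω ∈ A n <;> simp [h1, h2]
    rw [this]; ring
  have hI : ∀ m n, Integrable (fun ω => ((A m).indicator (fun _ => (1:ℝ)) ω - P.real (A m)) * ((A n).indicator (fun _ => (1:ℝ)) ω - P.real (A n))) P := by
    intro m n
    simp only [hInteg]
    exact (((hi _ ((hA m).inter (hA n))).sub ((hi _ (hA m)).const_mul _)).sub ((hi _ (hA n)).const_mul _)).add (integrable_const _)
  simp only [sq, Finset.sum_mul_sum]
  rw [integral_finsetSum _ (fun m _ => integrable_finsetSum _ fun n _ => hI m n)]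
  refine Finset.sum_congr rfl fun m _ => ?_
  rw [integral_finsetSum _ (fun n _ => hI m n)]
  refine Finset.sum_congr rfl fun n _ => ?_
  have i1 := hi _ ((hA m).inter (hA n))
  have i2 := (hi _ (hA m)).const_mul (P.real (A n))
  have i3 := (hi _ (hA n)).const_mul (P.real (A m))
  simp only [hInteg]
  have e1 : ∀ B : Set Ω, MeasurableSet B → ∫ ω, B.indicator (fun _ => (1:ℝ)) ω ∂P = P.real B := by
    intro B hB
    rw [integral_indicator hB]; simp
  rw [integral_add (f := fun ω => (A m ∩ A n).indicator (fun _ => (1:ℝ)) ω - P.real (A n) * (A m).indicator (fun _ => (1:ℝ)) ω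
        - P.real (A m) * (A n).indicator (fun _ => (1:ℝ)) ω) (g := fun _ => P.real (A m) * P.real (A n)) ((i1.sub i2).sub i3) (integrable_const _),
    integral_sub (f := fun ω => (A m ∩ A n).indicator (fun _ => (1:ℝ)) ω - P.real (A n) * (A m).indicator (fun _ => (1:ℝ)) ω)
      (i1.sub i2) i3, integral_sub i1 i2, integral_const_mul, integral_const_mul, e1 _ (hA m), e1 _ (hA n), e1 _ ((hA m).inter (hA n))]
  simp
  ring

lemma sym_sum {ι : Type*} (F : Finset ι) (κ : ι → ι → ℝ) (hκ : ∀ m n, 0 ≤ κ m n) (hs : ∀ m n, κ m n = κ n m)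
    (w : ι → ℝ) (h : ι → ℝ) (hh : ∀ m ∈ F, ∑ n ∈ F with w n ≤ w m, κ m n ≤ h m) :
    ∑ m ∈ F, ∑ n ∈ F, κ m n ≤ 2 * ∑ m ∈ F, h m := by
  have h1 : ∑ m ∈ F, ∑ n ∈ F with w n ≤ w m, κ m n ≤ ∑ m ∈ F, h m := Finset.sum_le_sum hh
  simp only [Finset.sum_filter] at h1
  have h2 : ∑ m ∈ F, ∑ n ∈ F, (if w m ≤ w n then κ m n else 0) = ∑ m ∈ F, ∑ n ∈ F, (if w n ≤ w m then κ m n else 0) := by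
    rw [Finset.sum_comm]
    refine Finset.sum_congr rfl fun m _ => Finset.sum_congr rfl fun n _ => ?_
    rw [hs]
  calc _ ≤ ∑ m ∈ F, ∑ n ∈ F, ((if w n ≤ w m then κ m n else 0) + (if w m ≤ w n then κ m n else 0)) := by
        refine Finset.sum_le_sum fun m _ => Finset.sum_le_sum fun n _ => ?_
        have := hκ m n
        rcases le_total (w n) (w m) with h | h
        · simp only [h, if_true]; split_ifs <;> linarith
        · simp only [h, if_true]; split_ifs <;> linarith
    _ ≤ _ := by simp only [Finset.sum_add_distrib]; linarith


/-- dominating function -/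
def hFun {d : ℕ} (S K κ : ℝ) (ν : Measure (EuclideanSpace ℝ (Fin d))) (r : ℝ) (x : EuclideanSpace ℝ (Fin d)) : ℝ :=
  if ‖x‖ ≤ 2 * r then S * (K / (1 + (‖x‖ - r) ^ 2)) else
    (κ * ‖x‖ + 1) ^ d * ν.real {y | x + y ∈ Metric.closedBall 0 r}

/-- set of displacements bringing `x` in the ball -/
def dispS {d : ℕ} (r : ℝ) (x : EuclideanSpace ℝ (Fin d)) : Set (EuclideanSpace ℝ (Fin d)) :=
  {y | x + y ∈ Metric.closedBall 0 r}

lemma dispS_meas {d : ℕ} (r : ℝ) (x : EuclideanSpace ℝ (Fin d)) : MeasurableSet (dispS r x) :=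
  (measurable_const_add x) Metric.isClosed_closedBall.measurableSet

lemma fixed_u_var {Ω : Type*} [MeasurableSpace Ω] (P : Measure Ω) [IsProbabilityMeasure P]
    {d : ℕ} (b : Module.Basis (Fin d) ℝ (EuclideanSpace ℝ (Fin d)))
    (p : (Fin d → ℤ) → Ω → EuclideanSpace ℝ (Fin d)) (hpm : ∀ m, Measurable (p m))
    (ν : Measure (EuclideanSpace ℝ (Fin d))) (hν : ∀ m, P.map (p m) = ν)
    (s q : ℝ) (hs : 0 < s) (hq : 0 < q) (hsq : 1/s + 1/q = 1)
    (hsum : Summable (fun m : Fin d → ℤ => (mixCoef P (latPt b) p ‖latPt b m‖) ^ (1/s)))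
    (K : ℝ) 
    (hT : ∀ (r : ℝ) (x : EuclideanSpace ℝ (Fin d)), ∃ T : ℝ, 0 ≤ T ∧
      (ν.real {y | x + y ∈ Metric.closedBall 0 r} ≤ T ∨ 1 - ν.real {y | x + y ∈ Metric.closedBall 0 r} ≤ T) ∧
      T ^ (1/q) ≤ K / (1 + (‖x‖ - r) ^ 2))
    (κ : ℝ) (hκ : ∀ (y u : EuclideanSpace ℝ (Fin d)) (r : ℝ), 0 ≤ r →
      (cntE b y r u).toReal ≤ (κ * r + 1) ^ d ∧ cntE b y r u ≠ ⊤)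
    (r : ℝ) (u : EuclideanSpace ℝ (Fin d)) (F : Finset (Fin d → ℤ)) :
    ∫ ω, (∑ m ∈ F, ((p m ⁻¹' dispS r (latPt b m + u)).indicator (fun _ => (1:ℝ)) ω
        - P.real (p m ⁻¹' dispS r (latPt b m + u)))) ^ 2 ∂P ≤
      2 * ∑ m ∈ F, hFun (∑' m : Fin d → ℤ, (mixCoef P (latPt b) p ‖latPt b m‖) ^ (1/s)) K κ ν r (latPt b m + u) := by
  set S := ∑' m : Fin d → ℤ, (mixCoef P (latPt b) p ‖latPt b m‖) ^ (1/s) with hS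
  set A : (Fin d → ℤ) → Set Ω := fun m => p m ⁻¹' dispS r (latPt b m + u) with hAdef
  have hA : ∀ m, MeasurableSet (A m) := fun m => hpm m (dispS_meas _ _)
  have hPA : ∀ m, P.real (A m) = ν.real {y | latPt b m + u + y ∈ Metric.closedBall 0 r} := by
    intro m
    rw [← hν m]
    exact (map_measureReal_apply (hpm m) (dispS_meas r (latPt b m + u))).symm
  have hfc := finite_cov_sum P A hA F
  simp only [hAdef] at hfc
  rw [hfc]
  set k : (Fin d → ℤ) → (Fin d → ℤ) → ℝ := fun m n => |P.real (A m) * P.real (A n) - P.real (A m ∩ A n)| with hk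
  refine le_trans (b := ∑ m ∈ F, ∑ n ∈ F, k m n) ?_ ?_
  · refine Finset.sum_le_sum fun m _ => Finset.sum_le_sum fun n _ => ?_
    simp only [hk]
    rw [abs_sub_comm]; exact le_abs_self _
  refine sym_sum F k (fun m n => abs_nonneg _) (fun m n => ?_) (fun m => ‖latPt b m + u‖) _ fun m hm => ?_
  · simp only [hk]
    rw [mul_comm, Set.inter_comm]
  unfold hFun
  split_ifs with hx
  · obtain ⟨T, hT0, hT1, hT2⟩ := hT r (latPt b m + u)
    rw [← hPA] at hT1
    have hkT : ∀ n, k m n ≤ T := fun n => by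
      have h := cov_le_left P (A m) (A n) (hA m)
      rcases hT1 with h1 | h1
      · exact h.1.trans h1
      · exact h.2.trans h1
    have hkα : ∀ n, k m n ≤ mixCoef P (latPt b) p ‖latPt b (m - n)‖ := fun n => by
      rw [latPt_sub]
      exact cov_le_mix P (latPt b) p m n _ _ (dispS_meas _ _) (dispS_meas _ _)
    have hsum2 : Summable (fun n : Fin d → ℤ => (mixCoef P (latPt b) p ‖latPt b (m - n)‖) ^ (1/s)) :=
      hsum.comp_injective (Equiv.subLeft m).injective
    have hS2 : ∑' n, (mixCoef P (latPt b) p ‖latPt b (m - n)‖) ^ (1/s) = S :=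
      (Equiv.subLeft m).tsum_eq (fun m => (mixCoef P (latPt b) p ‖latPt b m‖) ^ (1/s))
    have hnn : ∀ x : ℝ, 0 ≤ (mixCoef P (latPt b) p x) ^ (1/s) := fun x => Real.rpow_nonneg (mix_nonneg _ _ _ _) _
    calc _ ≤ ∑ n ∈ F, k m n := Finset.sum_le_sum_of_subset_of_nonneg (Finset.filter_subset _ _) fun _ _ _ => abs_nonneg _
      _ ≤ ∑ n ∈ F, (mixCoef P (latPt b) p ‖latPt b (m - n)‖) ^ (1/s) * T ^ (1/q) :=
        Finset.sum_le_sum fun n _ => min_rpow_bound (abs_nonneg _) (hkα n) (hkT n) hs hq hsq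
      _ = (∑ n ∈ F, (mixCoef P (latPt b) p ‖latPt b (m - n)‖) ^ (1/s)) * T ^ (1/q) := by rw [Finset.sum_mul]
      _ ≤ S * (K / (1 + (‖latPt b m + u‖ - r) ^ 2)) := by
        refine mul_le_mul ?_ hT2 (by positivity) (tsum_nonneg fun _ => hnn _)
        rw [← hS2]
        exact hsum2.sum_le_tsum _ fun n _ => hnn _
  · set R := ‖latPt b m + u‖ with hR
    calc _ ≤ ∑ n ∈ F with ‖latPt b n + u‖ ≤ R, P.real (A m) :=
          Finset.sum_le_sum fun n _ => (cov_le_left P (A m) (A n) (hA m)).1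
      _ = ((F.filter fun n => ‖latPt b n + u‖ ≤ R).card : ℝ) * P.real (A m) := by rw [Finset.sum_const, nsmul_eq_mul]
      _ ≤ (κ * R + 1) ^ d * P.real (A m) := by
        gcongr
        obtain ⟨h1, h2⟩ := hκ 0 u R (norm_nonneg _)
        refine le_trans ?_ h1
        have h3 : ((F.filter fun n => ‖latPt b n + u‖ ≤ R).card : ENNReal) ≤ cntE b 0 R u := by
          unfold cntE
          refine le_trans ?_ (ENNReal.sum_le_tsum (F.filter fun n => ‖latPt b n + u‖ ≤ R))
          rw [Finset.card_eq_sum_ones, Nat.cast_sum]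
          refine Finset.sum_le_sum fun n hn => ?_
          rw [Set.indicator_of_mem]
          · simp
          · simpa using (Finset.mem_filter.1 hn).2
        have h4 := ENNReal.toReal_mono h2 h3
        simpa using h4
      _ = _ := by rw [hPA]


lemma near_int {d : ℕ} (hd : 1 ≤ d) : ∃ C : ℝ, 0 ≤ C ∧ ∀ r : ℝ, 1 ≤ r →
    ∫⁻ x in {x : EuclideanSpace ℝ (Fin d) | ‖x‖ ≤ 2 * r}, ENNReal.ofReal ((1 + (‖x‖ - r) ^ 2)⁻¹) ≤ ENNReal.ofReal (C * r ^ (d - 1)) := by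
  have : Nonempty (Fin d) := ⟨⟨0, hd⟩⟩
  have : Nontrivial (EuclideanSpace ℝ (Fin d)) := inferInstance
  set w := (volume : Measure (EuclideanSpace ℝ (Fin d))).real (Metric.ball 0 1)
  have hw : 0 ≤ w := measureReal_nonneg
  refine ⟨d * w * 2 ^ (d - 1) * Real.pi, by positivity, fun r hr => ?_⟩
  let f : ℝ → ℝ := (Set.Iic (2 * r)).indicator (fun t => (1 + (t - r) ^ 2)⁻¹)
  have hms : MeasurableSet {x : EuclideanSpace ℝ (Fin d) | ‖x‖ ≤ 2 * r} := measurableSet_le measurable_norm measurable_const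
  have hfm : Measurable f := by
    refine Measurable.indicator ?_ measurableSet_Iic
    fun_prop
  have hf0 : ∀ t, 0 ≤ f t := fun t => Set.indicator_nonneg (fun t _ => by positivity) t
  have heq : ∀ x : EuclideanSpace ℝ (Fin d), ({x : EuclideanSpace ℝ (Fin d) | ‖x‖ ≤ 2 * r}).indicator (fun x => ENNReal.ofReal ((1 + (‖x‖ - r) ^ 2)⁻¹)) x = ENNReal.ofReal (f ‖x‖) := by
    intro x
    by_cases h : ‖x‖ ≤ 2 * r
    · rw [Set.indicator_of_mem (show x ∈ {x : EuclideanSpace ℝ (Fin d) | ‖x‖ ≤ 2 * r} from h)]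
      simp only [f]
      rw [Set.indicator_of_mem (show ‖x‖ ∈ Set.Iic (2 * r) from h)]
    · rw [Set.indicator_of_notMem (show x ∉ {x : EuclideanSpace ℝ (Fin d) | ‖x‖ ≤ 2 * r} from h)]
      simp only [f]
      rw [Set.indicator_of_notMem (show ‖x‖ ∉ Set.Iic (2 * r) from h)]; simp
  rw [← lintegral_indicator hms]
  simp only [heq]
  have hInteg : Integrable (fun x : EuclideanSpace ℝ (Fin d) => f ‖x‖) := by
    have h1 : IntegrableOn (fun x : EuclideanSpace ℝ (Fin d) => f ‖x‖) (Metric.closedBall 0 (2 * r)) := by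
      refine Measure.integrableOn_of_bounded (M := 1) (isCompact_closedBall _ _).measure_lt_top.ne (hfm.comp measurable_norm).aestronglyMeasurable (ae_of_all _ fun x => ?_)
      rw [Real.norm_of_nonneg (hf0 _)]
      refine Set.indicator_le' (fun t _ => ?_) (fun _ _ => zero_le_one) _
      exact inv_le_one_of_one_le₀ (by nlinarith [sq_nonneg (t - r)])
    rw [integrableOn_iff_integrable_of_support_subset] at h1
    · exact h1
    · intro x hx
      by_contra h
      refine hx ?_
      exact Set.indicator_of_notMem (fun h2 => h (by simpa using h2)) _
  rw [← ofReal_integral_eq_lintegral_ofReal hInteg (ae_of_all _ fun x => hf0 _)]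
  apply ENNReal.ofReal_le_ofReal
  rw [integral_fun_norm_addHaar volume f, finrank_euclideanSpace, Fintype.card_fin]
  have hi : Integrable (fun t : ℝ => (2 * r) ^ (d - 1) * (1 + (t - r) ^ 2)⁻¹) :=
    (integrable_inv_one_add_sq.comp_sub_right r).const_mul _
  have hle : ∫ t in Set.Ioi (0:ℝ), t ^ (d - 1) • f t ≤ (2 * r) ^ (d - 1) * Real.pi := by
    calc _ ≤ ∫ t in Set.Ioi (0:ℝ), (2 * r) ^ (d - 1) * (1 + (t - r) ^ 2)⁻¹ := by
          refine setIntegral_mono_on₀ ?_ hi.integrableOn measurableSet_Ioi.nullMeasurableSet fun t ht => ?_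
          · refine Integrable.mono hi.integrableOn (by fun_prop) ?_
            filter_upwards [ae_restrict_mem measurableSet_Ioi] with t ht
            have ht0 : 0 < t := ht
            rw [Real.norm_of_nonneg (smul_nonneg (by positivity) (hf0 _)), Real.norm_of_nonneg (by positivity)]
            by_cases h : t ≤ 2 * r
            · simp only [f]
              rw [Set.indicator_of_mem (show t ∈ Set.Iic (2 * r) from h), smul_eq_mul]
              gcongr
            · simp only [f]
              rw [Set.indicator_of_notMem (show t ∉ Set.Iic (2 * r) from h), smul_zero]
              positivity
          · have ht0 : 0 < t := ht
            by_cases h : t ≤ 2 * r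
            · simp only [f]
              rw [Set.indicator_of_mem (show t ∈ Set.Iic (2 * r) from h), smul_eq_mul]
              gcongr
            · simp only [f]
              rw [Set.indicator_of_notMem (show t ∉ Set.Iic (2 * r) from h), smul_zero]
              positivity
      _ ≤ ∫ t : ℝ, (2 * r) ^ (d - 1) * (1 + (t - r) ^ 2)⁻¹ :=
          setIntegral_le_integral hi (ae_of_all _ fun t => by positivity)
      _ = _ := by
          rw [integral_const_mul, integral_sub_right_eq_self (fun t : ℝ => (1 + t ^ 2)⁻¹) r, integral_univ_inv_one_add_sq]
  rw [nsmul_eq_mul, smul_eq_mul]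
  calc (d:ℝ) * (w * ∫ t in Set.Ioi (0:ℝ), t ^ (d - 1) • f t) ≤ d * (w * ((2 * r) ^ (d - 1) * Real.pi)) := by gcongr
    _ = _ := by rw [mul_pow]; ring

lemma far_int {d : ℕ} (hd : 1 ≤ d) (ν : Measure (EuclideanSpace ℝ (Fin d))) [IsProbabilityMeasure ν] (q : ℝ) (hq : (d:ℝ) ≤ q)
    (hm : ∫⁻ y, (‖y‖₊ : ENNReal) ^ (2 * q) ∂ν < ⊤) (κ : ℝ) (hκ : 0 ≤ κ) :
    ∃ C : ℝ, 0 ≤ C ∧ ∀ r : ℝ, 1 ≤ r →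
    ∫⁻ x in {x : EuclideanSpace ℝ (Fin d) | 2 * r < ‖x‖}, ENNReal.ofReal ((κ * ‖x‖ + 1) ^ d) * ν (dispS r x) ≤ ENNReal.ofReal C := by
  set w := (volume : Measure (EuclideanSpace ℝ (Fin d))) (Metric.ball 0 1) with hw
  have hwt : w ≠ ⊤ := measure_ball_lt_top.ne
  set I := ∫⁻ y, (‖y‖₊ : ENNReal) ^ (2 * q) ∂ν with hI
  have hq0 : 0 < q := lt_of_lt_of_le (by exact_mod_cast hd) hq
  refine ⟨(ENNReal.ofReal ((2 * κ + 1) ^ d) * w * I).toReal, ENNReal.toReal_nonneg, fun r hr => ?_⟩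
  rw [ENNReal.ofReal_toReal (ENNReal.mul_ne_top (ENNReal.mul_ne_top ENNReal.ofReal_ne_top hwt) hm.ne)]
  have hms : MeasurableSet {x : EuclideanSpace ℝ (Fin d) | 2 * r < ‖x‖} := measurableSet_lt measurable_const measurable_norm
  have hmsp : MeasurableSet {z : EuclideanSpace ℝ (Fin d) × EuclideanSpace ℝ (Fin d) | z.1 + z.2 ∈ Metric.closedBall 0 r} :=
    (measurable_fst.add measurable_snd) Metric.isClosed_closedBall.measurableSet
  let ψ : EuclideanSpace ℝ (Fin d) → EuclideanSpace ℝ (Fin d) → ENNReal := fun x y =>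
    ENNReal.ofReal ((κ * ‖x‖ + 1) ^ d) * (Metric.closedBall 0 r).indicator (fun _ => (1:ENNReal)) (x + y)
  have hψm : Measurable (Function.uncurry ψ) := by
    refine Measurable.mul (by fun_prop) ?_
    exact (measurable_const.indicator Metric.isClosed_closedBall.measurableSet).comp (measurable_fst.add measurable_snd)
  have h1 : ∀ x, ENNReal.ofReal ((κ * ‖x‖ + 1) ^ d) * ν (dispS r x) = ∫⁻ y, ψ x y ∂ν := by
    intro x
    simp only [ψ]
    rw [lintegral_const_mul' _ _ ENNReal.ofReal_ne_top]
    congr 1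
    rw [← lintegral_indicator_one (dispS_meas r x)]
    rfl
  simp only [h1]
  rw [lintegral_lintegral_swap hψm.aemeasurable, hI, ← lintegral_const_mul' _ _ (ENNReal.mul_ne_top ENNReal.ofReal_ne_top hwt)]
  refine lintegral_mono fun y => ?_
  rw [← lintegral_indicator hms]
  by_cases hy : r ≤ ‖y‖
  · have hb : ∀ x, ({x : EuclideanSpace ℝ (Fin d) | 2 * r < ‖x‖}).indicator (fun x => ψ x y) x ≤
        ENNReal.ofReal ((κ * (2 * ‖y‖) + 1) ^ d) * (Metric.closedBall (-y) r).indicator (fun _ => (1:ENNReal)) x := by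
      intro x
      by_cases hx : x ∈ {x : EuclideanSpace ℝ (Fin d) | 2 * r < ‖x‖}
      swap
      · rw [Set.indicator_of_notMem hx]; exact zero_le
      rw [Set.indicator_of_mem hx]
      have hx' : 2 * r < ‖x‖ := hx
      simp only [ψ]
      by_cases hxy : x + y ∈ Metric.closedBall 0 r
      · rw [Set.indicator_of_mem hxy, Set.indicator_of_mem (by simpa [dist_eq_norm] using hxy)]
        gcongr
        have h3 : ‖x + y‖ ≤ r := by simpa using hxy
        have := norm_sub_norm_le x (-y)
        rw [norm_neg, sub_neg_eq_add] at this
        linarith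
      · rw [Set.indicator_of_notMem hxy]; simp
    refine (lintegral_mono hb).trans ?_
    rw [lintegral_const_mul' _ _ ENNReal.ofReal_ne_top, lintegral_indicator_const Metric.isClosed_closedBall.measurableSet, one_mul,
      Measure.addHaar_closedBall _ _ (by linarith), finrank_euclideanSpace, Fintype.card_fin, ← hw]
    have h4 : (‖y‖₊ : ENNReal) ^ (2 * q) = ENNReal.ofReal (‖y‖ ^ (2 * q)) := by
      rw [← ENNReal.ofReal_rpow_of_nonneg (norm_nonneg _) (by positivity), ofReal_norm, enorm_eq_nnnorm]
    rw [h4, ← mul_assoc, mul_right_comm _ w, ← ENNReal.ofReal_mul (by positivity), ← ENNReal.ofReal_mul (by positivity)]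
    refine mul_le_mul' (ENNReal.ofReal_le_ofReal ?_) le_rfl
    have hy1 : 1 ≤ ‖y‖ := hr.trans hy
    calc (κ * (2 * ‖y‖) + 1) ^ d * r ^ d ≤ ((2 * κ + 1) * ‖y‖) ^ d * ‖y‖ ^ d := by
          gcongr; nlinarith
      _ = (2 * κ + 1) ^ d * ‖y‖ ^ ((2 * d : ℕ) : ℝ) := by rw [Real.rpow_natCast, mul_pow]; ring
      _ ≤ _ := by
          refine mul_le_mul_of_nonneg_left (Real.rpow_le_rpow_of_exponent_le hy1 ?_) (by positivity)
          push_cast; linarith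
  · have hz : ∀ x, ({x : EuclideanSpace ℝ (Fin d) | 2 * r < ‖x‖}).indicator (fun x => ψ x y) x = 0 := by
      intro x
      refine Set.indicator_apply_eq_zero.2 fun hx => ?_
      have hx' : 2 * r < ‖x‖ := hx
      simp only [ψ]
      rw [Set.indicator_of_notMem, mul_zero]
      intro hxy
      have h3 : ‖x + y‖ ≤ r := by simpa using hxy
      have := norm_sub_norm_le x (-y)
      rw [norm_neg, sub_neg_eq_add] at this
      linarith
    simp only [hz, lintegral_zero]
    exact zero_le


lemma dispS_joint {d : ℕ} (ν : Measure (EuclideanSpace ℝ (Fin d))) [IsProbabilityMeasure ν] (r : ℝ) :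
    Measurable (fun x => ν (dispS r x)) := by
  have hmsp : MeasurableSet {z : EuclideanSpace ℝ (Fin d) × EuclideanSpace ℝ (Fin d) | z.1 + z.2 ∈ Metric.closedBall 0 r} :=
    (measurable_fst.add measurable_snd) Metric.isClosed_closedBall.measurableSet
  exact measurable_measure_prodMk_left hmsp

lemma hFun_meas {d : ℕ} (S K κ : ℝ) (ν : Measure (EuclideanSpace ℝ (Fin d))) [IsProbabilityMeasure ν] (r : ℝ) :
    Measurable (hFun S K κ ν r) := by
  unfold hFun
  refine Measurable.ite (measurableSet_le measurable_norm measurable_const) (by fun_prop) ?_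
  refine Measurable.mul (by fun_prop) ?_
  exact (dispS_joint ν r).ennreal_toReal

lemma hFun_int {d : ℕ} (hd : 1 ≤ d) (S K κ : ℝ) (hS : 0 ≤ S) (hK : 0 ≤ K) (hκ : 0 ≤ κ)
    (ν : Measure (EuclideanSpace ℝ (Fin d))) [IsProbabilityMeasure ν] (q : ℝ) (hq : (d:ℝ) ≤ q)
    (hm : ∫⁻ y, (‖y‖₊ : ENNReal) ^ (2 * q) ∂ν < ⊤) :
    ∃ C : ℝ, 0 ≤ C ∧ ∀ r : ℝ, 1 ≤ r → ∫⁻ x, ENNReal.ofReal (hFun S K κ ν r x) ≤ ENNReal.ofReal (C * r ^ (d - 1)) := by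
  obtain ⟨C₁, hC₁, h₁⟩ := near_int hd
  obtain ⟨C₂, hC₂, h₂⟩ := far_int hd ν q hq hm κ hκ
  refine ⟨S * K * C₁ + C₂, by positivity, fun r hr => ?_⟩
  have hms : MeasurableSet {x : EuclideanSpace ℝ (Fin d) | ‖x‖ ≤ 2 * r} := measurableSet_le measurable_norm measurable_const
  rw [← lintegral_add_compl _ hms]
  have e1 : ∫⁻ x in {x : EuclideanSpace ℝ (Fin d) | ‖x‖ ≤ 2 * r}, ENNReal.ofReal (hFun S K κ ν r x) ≤
      ENNReal.ofReal (S * K * C₁ * r ^ (d - 1)) := by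
    have : ∀ x ∈ {x : EuclideanSpace ℝ (Fin d) | ‖x‖ ≤ 2 * r}, ENNReal.ofReal (hFun S K κ ν r x) = ENNReal.ofReal (S * K) * ENNReal.ofReal ((1 + (‖x‖ - r) ^ 2)⁻¹) := by
      intro x hx
      have hx' : ‖x‖ ≤ 2 * r := hx
      rw [hFun, if_pos hx', ← ENNReal.ofReal_mul (by positivity), div_eq_mul_inv, mul_assoc]
    rw [setLIntegral_congr_fun hms this, lintegral_const_mul' _ _ ENNReal.ofReal_ne_top, mul_assoc (S * K), ENNReal.ofReal_mul (p := S * K) (q := C₁ * r ^ (d - 1)) (by positivity)]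
    exact mul_le_mul' le_rfl (h₁ r hr)
  have e2 : ∫⁻ x in {x : EuclideanSpace ℝ (Fin d) | ‖x‖ ≤ 2 * r}ᶜ, ENNReal.ofReal (hFun S K κ ν r x) ≤
      ENNReal.ofReal (C₂ * r ^ (d - 1)) := by
    have hc : {x : EuclideanSpace ℝ (Fin d) | ‖x‖ ≤ 2 * r}ᶜ = {x | 2 * r < ‖x‖} := by ext; simp
    rw [hc]
    have : ∀ x ∈ {x : EuclideanSpace ℝ (Fin d) | 2 * r < ‖x‖}, ENNReal.ofReal (hFun S K κ ν r x) = ENNReal.ofReal ((κ * ‖x‖ + 1) ^ d) * ν (dispS r x) := by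
      intro x hx
      have hx' : 2 * r < ‖x‖ := hx
      rw [hFun, if_neg (not_le.2 hx'), ENNReal.ofReal_mul (by positivity)]
      congr 1
      exact ofReal_measureReal
    rw [setLIntegral_congr_fun (measurableSet_lt measurable_const measurable_norm) this]
    refine (h₂ r hr).trans (ENNReal.ofReal_le_ofReal ?_)
    exact le_mul_of_one_le_right hC₂ (one_le_pow₀ hr)
  refine (add_le_add e1 e2).trans ?_
  rw [← ENNReal.ofReal_add (by positivity) (by positivity)]
  exact ENNReal.ofReal_le_ofReal (by nlinarith)

/-- number of perturbed points for a fixed shift -/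
def nCnt {d : ℕ} (b : Module.Basis (Fin d) ℝ (EuclideanSpace ℝ (Fin d)))
    (r : ℝ) (u : EuclideanSpace ℝ (Fin d)) (p : (Fin d → ℤ) → EuclideanSpace ℝ (Fin d)) : ENNReal :=
  ∑' m, (Metric.closedBall 0 r).indicator (fun _ => (1:ENNReal)) (latPt b m + u + p m)

/-- mean number of perturbed points for a fixed shift -/
def mCnt {d : ℕ} (b : Module.Basis (Fin d) ℝ (EuclideanSpace ℝ (Fin d))) (ν : Measure (EuclideanSpace ℝ (Fin d)))
    (r : ℝ) (u : EuclideanSpace ℝ (Fin d)) : ENNReal := ∑' m, ν (dispS r (latPt b m + u))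

lemma disp_ind {d : ℕ} (ν : Measure (EuclideanSpace ℝ (Fin d))) (r : ℝ) (x : EuclideanSpace ℝ (Fin d)) :
    ν (dispS r x) = ∫⁻ y, (Metric.closedBall 0 r).indicator (fun _ => (1:ENNReal)) (x + y) ∂ν := by
  rw [← lintegral_indicator_one (dispS_meas r x)]
  rfl

lemma mCnt_eq {d : ℕ} (b : Module.Basis (Fin d) ℝ (EuclideanSpace ℝ (Fin d))) (ν : Measure (EuclideanSpace ℝ (Fin d)))
    (r : ℝ) (u : EuclideanSpace ℝ (Fin d)) : mCnt b ν r u = ∫⁻ y, cntE b 0 r (u + y) ∂ν := by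
  unfold mCnt cntE
  rw [lintegral_tsum]
  · refine tsum_congr fun m => ?_
    rw [disp_ind]
    simp only [add_assoc]
  · intro m
    exact ((measurable_const.indicator Metric.isClosed_closedBall.measurableSet).comp
      ((measurable_const_add _).comp (measurable_const_add _))).aemeasurable

lemma nCnt_lint {Ω : Type*} [MeasurableSpace Ω] (P : Measure Ω) 
    {d : ℕ} (b : Module.Basis (Fin d) ℝ (EuclideanSpace ℝ (Fin d)))
    (p : (Fin d → ℤ) → Ω → EuclideanSpace ℝ (Fin d)) (hpm : ∀ m, Measurable (p m))
    (ν : Measure (EuclideanSpace ℝ (Fin d))) (hν : ∀ m, P.map (p m) = ν) (r : ℝ) (u : EuclideanSpace ℝ (Fin d)) :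
    ∫⁻ ω, nCnt b r u (fun m => p m ω) ∂P = mCnt b ν r u := by
  have hind : Measurable ((Metric.closedBall (0 : EuclideanSpace ℝ (Fin d)) r).indicator (fun _ => (1:ENNReal))) :=
    measurable_const.indicator Metric.isClosed_closedBall.measurableSet
  unfold nCnt mCnt
  rw [lintegral_tsum]
  · refine tsum_congr fun m => ?_
    rw [disp_ind, ← hν m, lintegral_map (f := fun y => (Metric.closedBall (0 : EuclideanSpace ℝ (Fin d)) r).indicator (fun _ => (1:ENNReal)) (latPt b m + u + y)) (hind.comp (measurable_const_add _)) (hpm m)]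
  · intro m
    exact (hind.comp ((measurable_const_add _).comp (hpm m))).aemeasurable

lemma fixed_u_lim {Ω : Type*} [MeasurableSpace Ω] (P : Measure Ω) [IsProbabilityMeasure P]
    {d : ℕ} (b : Module.Basis (Fin d) ℝ (EuclideanSpace ℝ (Fin d)))
    (p : (Fin d → ℤ) → Ω → EuclideanSpace ℝ (Fin d)) (hpm : ∀ m, Measurable (p m))
    (ν : Measure (EuclideanSpace ℝ (Fin d))) (hν : ∀ m, P.map (p m) = ν)
    (r : ℝ) (u : EuclideanSpace ℝ (Fin d)) (hfin : mCnt b ν r u ≠ ⊤) (h : EuclideanSpace ℝ (Fin d) → ℝ)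
    (hh0 : ∀ x, 0 ≤ h x)
    (hh : ∀ F : Finset (Fin d → ℤ), ∫ ω, (∑ m ∈ F, ((p m ⁻¹' dispS r (latPt b m + u)).indicator (fun _ => (1:ℝ)) ω
        - P.real (p m ⁻¹' dispS r (latPt b m + u)))) ^ 2 ∂P ≤
      2 * ∑ m ∈ F, h (latPt b m + u)) :
    ∫⁻ ω, ENNReal.ofReal (((nCnt b r u (fun m => p m ω)).toReal - (mCnt b ν r u).toReal) ^ 2) ∂P ≤
      2 * ∑' m, ENNReal.ofReal (h (latPt b m + u)) := by
  have hind : Measurable ((Metric.closedBall (0 : EuclideanSpace ℝ (Fin d)) r).indicator (fun _ => (1:ENNReal))) :=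
    measurable_const.indicator Metric.isClosed_closedBall.measurableSet
  have hNm : Measurable (fun ω => nCnt b r u (fun m => p m ω)) :=
    Measurable.tsum fun m => hind.comp ((measurable_const_add _).comp (hpm m))
  have hae : ∀ᵐ ω ∂P, nCnt b r u (fun m => p m ω) < ⊤ :=
    ae_lt_top hNm (by rw [nCnt_lint P b p hpm ν hν]; exact hfin)
  set A : (Fin d → ℤ) → Set Ω := fun m => p m ⁻¹' dispS r (latPt b m + u) with hAdef
  have hA : ∀ m, MeasurableSet (A m) := fun m => hpm m (dispS_meas _ _)
  have hPA : ∀ m, P.real (A m) = (ν (dispS r (latPt b m + u))).toReal := by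
    intro m
    rw [← hν m, Measure.map_apply (hpm m) (dispS_meas r (latPt b m + u))]
    rfl
  have hM : HasSum (fun m => P.real (A m)) (mCnt b ν r u).toReal := by
    simp only [hPA]
    have := ENNReal.hasSum_toReal hfin
    rwa [← ENNReal.tsum_toReal_eq (fun m => ENNReal.ne_top_of_tsum_ne_top hfin m)] at this
  have hlim : ∀ᵐ ω ∂P, Tendsto (fun F : Finset (Fin d → ℤ) => ENNReal.ofReal ((∑ m ∈ F, ((A m).indicator (fun _ => (1:ℝ)) ω - P.real (A m))) ^ 2)) atTop
      (nhds (ENNReal.ofReal (((nCnt b r u (fun m => p m ω)).toReal - (mCnt b ν r u).toReal) ^ 2))) := by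
    filter_upwards [hae] with ω hω
    have h1 : HasSum (fun m => (A m).indicator (fun _ => (1:ℝ)) ω) (nCnt b r u (fun m => p m ω)).toReal := by
      have h2 := ENNReal.hasSum_toReal hω.ne
      rw [← ENNReal.tsum_toReal_eq (fun m => ENNReal.ne_top_of_tsum_ne_top hω.ne m)] at h2
      have h4 : (fun m => (A m).indicator (fun _ => (1:ℝ)) ω) = fun m =>
          ((Metric.closedBall 0 r).indicator (fun _ => (1:ENNReal)) (latPt b m + u + p m ω)).toReal := by
        funext m
        by_cases hm : latPt b m + u + p m ω ∈ Metric.closedBall 0 r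
        · rw [Set.indicator_of_mem hm, Set.indicator_of_mem (show ω ∈ A m from hm)]; simp
        · rw [Set.indicator_of_notMem hm, Set.indicator_of_notMem (show ω ∉ A m from hm)]; simp
      rw [h4]
      exact h2
    have h3 := h1.sub hM
    exact (ENNReal.continuous_ofReal.tendsto _).comp (h3.pow 2)
  have hmF : ∀ F : Finset (Fin d → ℤ), Measurable (fun ω => (∑ m ∈ F, ((A m).indicator (fun _ => (1:ℝ)) ω - P.real (A m))) ^ 2) := by
    intro F
    refine Measurable.pow_const (Finset.measurable_fun_sum _ fun m _ => ?_) 2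
    exact (measurable_const.indicator (hA m)).sub_const _
  have hbd : ∀ F : Finset (Fin d → ℤ), ∫⁻ ω, ENNReal.ofReal ((∑ m ∈ F, ((A m).indicator (fun _ => (1:ℝ)) ω - P.real (A m))) ^ 2) ∂P ≤
      2 * ∑' m, ENNReal.ofReal (h (latPt b m + u)) := by
    intro F
    have hi : Integrable (fun ω => (∑ m ∈ F, ((A m).indicator (fun _ => (1:ℝ)) ω - P.real (A m))) ^ 2) P := by
      refine Integrable.of_bound (hmF F).aestronglyMeasurable ((∑ m ∈ F, (1:ℝ)) ^ 2) (ae_of_all _ fun ω => ?_)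
      rw [norm_pow]
      refine pow_le_pow_left₀ (norm_nonneg _) ((norm_sum_le _ _).trans (Finset.sum_le_sum fun m _ => ?_)) 2
      have h1 : P.real (A m) ≤ 1 := measureReal_le_one
      have h2 : 0 ≤ P.real (A m) := measureReal_nonneg
      rw [Real.norm_eq_abs, abs_le]
      by_cases hm : ω ∈ A m
      · rw [Set.indicator_of_mem hm]; constructor <;> linarith
      · rw [Set.indicator_of_notMem hm]; constructor <;> linarith
    rw [← ofReal_integral_eq_lintegral_ofReal hi (ae_of_all _ fun ω => sq_nonneg _)]
    refine (ENNReal.ofReal_le_ofReal (hh F)).trans ?_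
    rw [ENNReal.ofReal_mul zero_le_two, ENNReal.ofReal_ofNat, ENNReal.ofReal_sum_of_nonneg (fun m _ => hh0 _)]
    gcongr
    exact ENNReal.sum_le_tsum F
  calc _ = ∫⁻ ω, liminf (fun F : Finset (Fin d → ℤ) => ENNReal.ofReal ((∑ m ∈ F, ((A m).indicator (fun _ => (1:ℝ)) ω - P.real (A m))) ^ 2)) atTop ∂P := by
        refine lintegral_congr_ae ?_
        filter_upwards [hlim] with ω hω
        rw [hω.liminf_eq]
    _ ≤ liminf (fun F : Finset (Fin d → ℤ) => ∫⁻ ω, ENNReal.ofReal ((∑ m ∈ F, ((A m).indicator (fun _ => (1:ℝ)) ω - P.real (A m))) ^ 2) ∂P) atTop :=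
        lintegral_liminf_le' fun F => (hmF F).ennreal_ofReal.aemeasurable
    _ ≤ liminf (fun _ : Finset (Fin d → ℤ) => 2 * ∑' m, ENNReal.ofReal (h (latPt b m + u))) atTop :=
        liminf_le_liminf (Eventually.of_forall hbd)
    _ = _ := liminf_const _


lemma cntE_shift {d : ℕ} (b : Module.Basis (Fin d) ℝ (EuclideanSpace ℝ (Fin d))) (r : ℝ)
    (u y : EuclideanSpace ℝ (Fin d)) : cntE b (-y) r u = cntE b 0 r (u + y) := by
  unfold cntE
  refine tsum_congr fun m => ?_
  have : latPt b m + u ∈ Metric.closedBall (-y) r ↔ latPt b m + (u + y) ∈ Metric.closedBall 0 r := by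
    simp [dist_eq_norm, add_assoc]
  by_cases h : latPt b m + u ∈ Metric.closedBall (-y) r
  · rw [Set.indicator_of_mem h, Set.indicator_of_mem (this.1 h)]
  · rw [Set.indicator_of_notMem h, Set.indicator_of_notMem (fun h' => h (this.2 h'))]

lemma sq_int_le {α : Type*} [MeasurableSpace α] (ν : Measure α) [IsProbabilityMeasure ν] (f : α → ℝ) (hf : Measurable f)
    (K : ℝ) (hK : ∀ x, ‖f x‖ ≤ K) : (∫ x, f x ∂ν) ^ 2 ≤ ∫ x, f x ^ 2 ∂ν := by
  have h1 : MemLp f 2 ν := MemLp.of_bound hf.aestronglyMeasurable K (ae_of_all _ hK)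
  have h2 := variance_eq_sub h1
  have h3 := variance_nonneg f ν
  simp only [Pi.pow_apply] at h2
  linarith

lemma mean_var {d : ℕ} (hd : 1 ≤ d) (b : Module.Basis (Fin d) ℝ (EuclideanSpace ℝ (Fin d)))
    (ν : Measure (EuclideanSpace ℝ (Fin d))) [IsProbabilityMeasure ν] :
    ∃ C : ℝ, 0 ≤ C ∧ ∀ r : ℝ, 0 < r →
      (∀ u, mCnt b ν r u ≠ ⊤) ∧
      ∫⁻ u in fdom b, ENNReal.ofReal (((mCnt b ν r u).toReal - volume.real (Metric.closedBall (0 : EuclideanSpace ℝ (Fin d)) r) / volume.real (fdom b)) ^ 2)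
        ≤ ENNReal.ofReal (C * r ^ (d - 1)) := by
  obtain ⟨C, hC, hlv⟩ := lattice_var b hd
  obtain ⟨κ, hκ, hcnt⟩ := cnt_bdd b
  refine ⟨C, hC, fun r hr => ⟨fun u => ?_, ?_⟩⟩
  · rw [mCnt_eq]
    refine ne_top_of_le_ne_top ?_ (lintegral_mono fun y => (hcnt 0 (u + y) r hr.le).1)
    simp
  set c := volume.real (Metric.closedBall (0 : EuclideanSpace ℝ (Fin d)) r) / volume.real (fdom b) with hc
  have hm := cntE_meas b 0 r
  have hm2 : Measurable (fun z : EuclideanSpace ℝ (Fin d) × EuclideanSpace ℝ (Fin d) => (cntE b 0 r (z.1 + z.2)).toReal - c) :=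
    ((hm.comp (measurable_fst.add measurable_snd)).ennreal_toReal).sub_const c
  have hbd : ∀ x, ‖(cntE b 0 r x).toReal - c‖ ≤ (κ * r + 1) ^ d + |c| := by
    intro x
    refine (norm_sub_le _ _).trans (add_le_add ?_ le_rfl)
    rw [Real.norm_of_nonneg ENNReal.toReal_nonneg]
    exact (hcnt 0 x r hr.le).2
  have hfin : IsFiniteMeasure (volume.restrict (fdom b)) := ⟨by
    rw [Measure.restrict_apply_univ]; exact (fdom_ne_top b).lt_top⟩
  have h1 : ∀ u, ENNReal.ofReal (((mCnt b ν r u).toReal - c) ^ 2) ≤ ∫⁻ y, ENNReal.ofReal (((cntE b 0 r (u + y)).toReal - c) ^ 2) ∂ν := by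
    intro u
    have hmu : Measurable (fun y => cntE b 0 r (u + y)) := hm.comp (measurable_const_add u)
    have e1 : (mCnt b ν r u).toReal = ∫ y, (cntE b 0 r (u + y)).toReal ∂ν := by
      rw [mCnt_eq, integral_toReal hmu.aemeasurable]
      exact ae_of_all _ fun y => lt_of_le_of_lt (hcnt 0 _ r hr.le).1 ENNReal.ofReal_lt_top
    have hi : Integrable (fun y => (cntE b 0 r (u + y)).toReal) ν := by
      refine Integrable.of_bound hmu.ennreal_toReal.aestronglyMeasurable ((κ * r + 1) ^ d) (ae_of_all _ fun y => ?_)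
      rw [Real.norm_of_nonneg ENNReal.toReal_nonneg]
      exact (hcnt 0 _ r hr.le).2
    have e2 : (mCnt b ν r u).toReal - c = ∫ y, ((cntE b 0 r (u + y)).toReal - c) ∂ν := by
      rw [integral_sub hi (integrable_const _), e1]; simp
    have hmu2 : Measurable (fun y => (cntE b 0 r (u + y)).toReal - c) := hmu.ennreal_toReal.sub_const c
    rw [e2, ← ofReal_integral_eq_lintegral_ofReal _ (ae_of_all _ fun y => sq_nonneg _)]
    · exact ENNReal.ofReal_le_ofReal (sq_int_le ν _ hmu2 _ fun y => hbd _)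
    · refine Integrable.of_bound (hmu2.pow_const 2).aestronglyMeasurable (((κ * r + 1) ^ d + |c|) ^ 2) (ae_of_all _ fun y => ?_)
      rw [norm_pow]
      exact pow_le_pow_left₀ (norm_nonneg _) (hbd _) 2
  refine (lintegral_mono h1).trans ?_
  rw [lintegral_lintegral_swap (hm2.pow_const 2).ennreal_ofReal.aemeasurable]
  calc _ ≤ ∫⁻ _y, ENNReal.ofReal (C * r ^ (d - 1)) ∂ν := by
        refine lintegral_mono fun y => ?_
        have hmy : Measurable (fun u => (cntE b 0 r (u + y)).toReal - c) :=
          (hm.comp (measurable_add_const y)).ennreal_toReal.sub_const c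
        simp only
        rw [← ofReal_integral_eq_lintegral_ofReal _ (ae_of_all _ fun y => sq_nonneg _)]
        · apply ENNReal.ofReal_le_ofReal
          have h2 := hlv (-y) r hr
          have hv : volume.real (Metric.closedBall (-y) r) = volume.real (Metric.closedBall (0 : EuclideanSpace ℝ (Fin d)) r) := by
            unfold Measure.real
            rw [Measure.addHaar_closedBall _ _ hr.le, Measure.addHaar_closedBall _ _ hr.le]
          rw [hv, ← hc] at h2
          simpa only [cntE_shift] using h2
        · refine Integrable.of_bound (hmy.pow_const 2).aestronglyMeasurable (((κ * r + 1) ^ d + |c|) ^ 2) (ae_of_all _ fun y => ?_)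
          rw [norm_pow]
          exact pow_le_pow_left₀ (norm_nonneg _) (hbd _) 2
    _ = _ := by simp


lemma nCnt_joint {d : ℕ} (b : Module.Basis (Fin d) ℝ (EuclideanSpace ℝ (Fin d))) (r : ℝ) :
    Measurable (fun z : EuclideanSpace ℝ (Fin d) × ((Fin d → ℤ) → EuclideanSpace ℝ (Fin d)) =>
      nCnt b r z.1 z.2) := by
  unfold nCnt
  refine Measurable.tsum fun m => ?_
  have h1 : Measurable ((Metric.closedBall (0 : EuclideanSpace ℝ (Fin d)) r).indicator
      (fun _ => (1 : ENNReal))) :=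
    measurable_const.indicator Metric.isClosed_closedBall.measurableSet
  refine h1.comp ?_
  exact (measurable_fst.const_add _).add ((measurable_pi_apply m).comp measurable_snd)

lemma mCnt_meas {d : ℕ} (b : Module.Basis (Fin d) ℝ (EuclideanSpace ℝ (Fin d)))
    (ν : Measure (EuclideanSpace ℝ (Fin d))) [IsProbabilityMeasure ν] (r : ℝ) :
    Measurable (fun u => mCnt b ν r u) := by
  unfold mCnt
  exact Measurable.tsum fun m => (dispS_joint ν r).comp (measurable_const_add _)

lemma hFun_nonneg {d : ℕ} (S K κ : ℝ) (hS : 0 ≤ S) (hK : 0 ≤ K) (hκ : 0 ≤ κ)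
    (ν : Measure (EuclideanSpace ℝ (Fin d))) (r : ℝ) (x : EuclideanSpace ℝ (Fin d)) :
    0 ≤ hFun S K κ ν r x := by
  unfold hFun
  split_ifs
  · positivity
  · positivity

lemma final_core {Ω : Type*} [MeasurableSpace Ω] (P : Measure Ω) [IsProbabilityMeasure P]
    {d : ℕ} (hd : 1 ≤ d) (b : Module.Basis (Fin d) ℝ (EuclideanSpace ℝ (Fin d)))
    (p : (Fin d → ℤ) → Ω → EuclideanSpace ℝ (Fin d)) (hpm : ∀ m, Measurable (p m))
    (ν : Measure (EuclideanSpace ℝ (Fin d))) [IsProbabilityMeasure ν] (hν : ∀ m, P.map (p m) = ν)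
    (U : Ω → EuclideanSpace ℝ (Fin d)) (hUmeas : Measurable U)
    (hU : Measure.map U P = (volume (fdom b))⁻¹ • volume.restrict (fdom b))
    (hindep : IndepFun U (fun ω => fun m : Fin d → ℤ => p m ω) P)
    (s q : ℝ) (hs : 0 < s) (hq : (d : ℝ) ≤ q) (hsq : 1/s + 1/q = 1)
    (hm : ∫⁻ y, (‖y‖₊ : ENNReal) ^ (2 * q) ∂ν < ⊤)
    (hsum : Summable (fun m : Fin d → ℤ => (mixCoef P (latPt b) p ‖latPt b m‖) ^ (1/s))) :
    ∃ C : ℝ, 0 ≤ C ∧ ∀ r : ℝ, 1 ≤ r →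
      variance (fun ω => (nCnt b r (U ω) (fun m => p m ω)).toReal) P ≤ C * r ^ (d - 1) := by
  have hq1 : 1 ≤ q := le_trans (by exact_mod_cast hd) hq
  obtain ⟨K, hK, hT⟩ := tail_bound ν q hq1 hm
  obtain ⟨κ, hκ, hcnt⟩ := cnt_bdd b
  set S := ∑' m : Fin d → ℤ, (mixCoef P (latPt b) p ‖latPt b m‖) ^ (1/s) with hSdef
  have hS : 0 ≤ S := tsum_nonneg fun m => Real.rpow_nonneg (mix_nonneg P _ p _) _
  obtain ⟨C1, hC1, h1⟩ := hFun_int hd S K κ hS hK hκ ν q hq hm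
  obtain ⟨C2, hC2, h2⟩ := mean_var hd b ν
  have hpM : Measurable (fun ω => fun m : Fin d → ℤ => p m ω) := measurable_pi_lambda _ hpm
  have hprod := (indepFun_iff_map_prod_eq_prod_map_map hUmeas.aemeasurable hpM.aemeasurable).1 hindep
  set w : ENNReal := (volume (fdom b))⁻¹ with hw
  have hwtop : w ≠ ⊤ := ENNReal.inv_ne_top.2 (fdom_ne_zero b)
  have hfix : ∀ r, 1 ≤ r → ∀ u, ∫⁻ ω, ENNReal.ofReal (((nCnt b r u fun m => p m ω).toReal
      - (mCnt b ν r u).toReal) ^ 2) ∂P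
      ≤ 2 * ∑' m, ENNReal.ofReal (hFun S K κ ν r (latPt b m + u)) := by
    intro r hr u
    refine fixed_u_lim P b p hpm ν hν r u ((h2 r (by linarith)).1 u) (hFun S K κ ν r)
      (hFun_nonneg S K κ hS hK hκ ν r) fun F => ?_
    exact fixed_u_var P b p hpm ν hν s q hs (by linarith) hsq hsum K hT κ
      (fun y u r hr => ⟨(hcnt y u r hr).2, ne_top_of_le_ne_top ENNReal.ofReal_ne_top (hcnt y u r hr).1⟩) r u F
  refine ⟨w.toReal * (4 * C1 + 2 * C2), by positivity, fun r hr => ?_⟩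
  have hr0 : 0 < r := by linarith
  set c := volume.real (Metric.closedBall (0 : EuclideanSpace ℝ (Fin d)) r) / volume.real (fdom b) with hc
  have hNm : Measurable (fun ω => (nCnt b r (U ω) (fun m => p m ω)).toReal) :=
    ((nCnt_joint b r).comp (hUmeas.prodMk hpM)).ennreal_toReal
  have hΦ : Measurable (fun z : EuclideanSpace ℝ (Fin d) × ((Fin d → ℤ) → EuclideanSpace ℝ (Fin d)) =>
      ENNReal.ofReal (((nCnt b r z.1 z.2).toReal - (mCnt b ν r z.1).toReal) ^ 2)) :=
    (((nCnt_joint b r).ennreal_toReal.sub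
      ((mCnt_meas b ν r).comp measurable_fst).ennreal_toReal).pow_const 2).ennreal_ofReal
  have e1 : ∫⁻ ω, ENNReal.ofReal (((nCnt b r (U ω) fun m => p m ω).toReal
      - (mCnt b ν r (U ω)).toReal) ^ 2) ∂P ≤ w * (2 * ENNReal.ofReal (C1 * r ^ (d - 1))) := by
    have := lintegral_map (μ := P) hΦ (hUmeas.prodMk hpM)
    rw [hprod, lintegral_prod _ hΦ.aemeasurable] at this
    simp only at this
    rw [← this, hU, lintegral_smul_measure, smul_eq_mul]
    refine mul_le_mul' le_rfl ?_
    calc _ ≤ ∫⁻ u in fdom b, 2 * ∑' m, ENNReal.ofReal (hFun S K κ ν r (latPt b m + u)) := by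
          refine lintegral_mono fun u => ?_
          exact (lintegral_map (hΦ.comp (measurable_prodMk_left (x := u))) hpM).trans_le (hfix r hr u)
      _ ≤ _ := by
          rw [lintegral_const_mul' _ _ (by simp), unfold_lint b
            (fun x => ENNReal.ofReal (hFun S K κ ν r x)) (hFun_meas S K κ ν r).ennreal_ofReal]
          exact mul_le_mul' le_rfl (h1 r hr)
  have hMm : Measurable (fun u => ENNReal.ofReal (((mCnt b ν r u).toReal - c) ^ 2)) :=
    (((mCnt_meas b ν r).ennreal_toReal.sub_const c).pow_const 2).ennreal_ofReal
  have e2 : ∫⁻ ω, ENNReal.ofReal (((mCnt b ν r (U ω)).toReal - c) ^ 2) ∂P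
      ≤ w * ENNReal.ofReal (C2 * r ^ (d - 1)) := by
    have := lintegral_map (μ := P) hMm hUmeas
    rw [← this, hU, lintegral_smul_measure, smul_eq_mul]
    exact mul_le_mul' le_rfl (h2 r hr0).2
  have e3 : ∫⁻ ω, ENNReal.ofReal (((nCnt b r (U ω) fun m => p m ω).toReal - c) ^ 2) ∂P
      ≤ ENNReal.ofReal (w.toReal * (4 * C1 + 2 * C2) * r ^ (d - 1)) := by
    calc _ ≤ ∫⁻ ω, (2 * ENNReal.ofReal (((nCnt b r (U ω) fun m => p m ω).toReal
                - (mCnt b ν r (U ω)).toReal) ^ 2)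
              + 2 * ENNReal.ofReal (((mCnt b ν r (U ω)).toReal - c) ^ 2)) ∂P := by
          refine lintegral_mono fun ω => ?_
          have h2' : (2 : ENNReal) = ENNReal.ofReal 2 := by simp
          simp only [h2']
          rw [← ENNReal.ofReal_mul (by norm_num), ← ENNReal.ofReal_mul (by norm_num),
            ← ENNReal.ofReal_add (by positivity) (by positivity)]
          refine ENNReal.ofReal_le_ofReal ?_
          generalize (nCnt b r (U ω) fun m => p m ω).toReal = x
          generalize (mCnt b ν r (U ω)).toReal = y
          nlinarith [sq_nonneg (x - y - (y - c))]
      _ ≤ 2 * (w * (2 * ENNReal.ofReal (C1 * r ^ (d - 1)))) + 2 * (w * ENNReal.ofReal (C2 * r ^ (d - 1))) := by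
          have hMU : Measurable (fun ω => 2 * ENNReal.ofReal (((mCnt b ν r (U ω)).toReal - c) ^ 2)) :=
            (hMm.comp hUmeas).const_mul 2
          rw [lintegral_add_right _ hMU,
            lintegral_const_mul' _ _ (by simp), lintegral_const_mul' _ _ (by simp)]
          exact add_le_add (mul_le_mul' le_rfl e1) (mul_le_mul' le_rfl e2)
      _ = _ := by
          have h2' : (2 : ENNReal) = ENNReal.ofReal 2 := by simp
          rw [← ENNReal.ofReal_toReal hwtop, h2', ← ENNReal.ofReal_mul (by norm_num),
            ← ENNReal.ofReal_mul (by positivity), ← ENNReal.ofReal_mul (by positivity),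
            ← ENNReal.ofReal_mul (by positivity), ← ENNReal.ofReal_mul (by positivity),
            ← ENNReal.ofReal_add (by positivity) (by positivity),
            ENNReal.toReal_ofReal (by positivity)]
          congr 1
          ring
  rw [← variance_sub_const hNm.aestronglyMeasurable c]
  refine (variance_le_expectation_sq (hNm.sub_const c).aestronglyMeasurable).trans ?_
  simp only [Pi.pow_apply]
  rw [integral_eq_lintegral_of_nonneg_ae (ae_of_all _ fun ω => sq_nonneg _)
    ((hNm.sub_const c).pow_const 2).aestronglyMeasurable]
  exact ENNReal.toReal_le_of_le_ofReal (by positivity) e3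

theorem statement1
    {Ω : Type*} [MeasurableSpace Ω] (P : Measure Ω) [IsProbabilityMeasure P]
    (d : ℕ) (hd : 1 ≤ d)
    -- the lattice 𝓛, generated by a basis `a` of ℝ^d
    (a : Fin d → EuclideanSpace ℝ (Fin d))
    (ha : LinearIndependent ℝ a)
    (Lpt : (Fin d → ℤ) → EuclideanSpace ℝ (Fin d))
    (hLpt : ∀ m, Lpt m = ∑ i, (m i : ℝ) • a i)
    -- the fundamental domain 𝒟
    (D : Set (EuclideanSpace ℝ (Fin d)))
    (hD : D = {x | ∃ t : Fin d → ℝ, (∀ i, t i ∈ Set.Ico (0:ℝ) 1) ∧ x = ∑ i, t i • a i})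
    -- the random field of perturbations
    (p : (Fin d → ℤ) → Ω → EuclideanSpace ℝ (Fin d))
    (hpm : ∀ m, Measurable (p m))
    -- strict stationarity of the field
    (hstat : ∀ (j : Fin d → ℤ) (Λ : Finset (Fin d → ℤ)),
      Measure.map (fun ω => fun m : Λ => p (↑m + j) ω) P =
      Measure.map (fun ω => fun m : Λ => p ↑m ω) P)
    -- U uniform on 𝒟, independent of the field
    (U : Ω → EuclideanSpace ℝ (Fin d))
    (hUmeas : Measurable U)
    (hU : Measure.map U P = (volume D)⁻¹ • volume.restrict D)
    (hindep : IndepFun U (fun ω => fun m : Fin d → ℤ => p m ω) P)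
    -- moment and mixing assumptions: ∃ s > 0, q ≥ d, 1/s + 1/q = 1, E|p₀|^q < ∞,
    -- ∑_{i ∈ 𝓛} α(|i|)^{1/s} < ∞
    (s q : ℝ) (hs : 0 < s) (hq : (d : ℝ) ≤ q) (hsq : 1/s + 1/q = 1)
    (hmom : ∫⁻ ω, (‖p 0 ω‖₊ : ENNReal) ^ q ∂P < ⊤)
    -- the law of p₀ is symmetric and E|p₀|^{2q} < ∞
    (hsymm : ∃ μ : EuclideanSpace ℝ (Fin d),
      Measure.map (fun ω => p 0 ω - μ) P = Measure.map (fun ω => μ - p 0 ω) P)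
    (hmom2 : ∫⁻ ω, (‖p 0 ω‖₊ : ENNReal) ^ (2 * q) ∂P < ⊤)
    (hsum : Summable (fun m : Fin d → ℤ => (mixCoef P Lpt p ‖Lpt m‖) ^ (1/s)))
    -- the number of points of the perturbed lattice Ξ in the closed ball B_r
    (N : ℝ → Ω → ℝ)
    (hN : ∀ r ω, N r ω = ∑' m : Fin d → ℤ,
      (Metric.closedBall (0 : EuclideanSpace ℝ (Fin d)) r).indicator (fun _ => (1:ℝ))
        (Lpt m + p m ω + U ω)) :
    -- Ξ is class I hyperuniform
    (fun r : ℝ =>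
      variance (N r) P /
        (volume (Metric.closedBall (0 : EuclideanSpace ℝ (Fin d)) r)).toReal)
      =O[atTop] (fun r : ℝ => r⁻¹) := by
  have hcard : Fintype.card (Fin d) = Module.finrank ℝ (EuclideanSpace ℝ (Fin d)) := by simp
  haveI : Nonempty (Fin d) := ⟨⟨0, hd⟩⟩
  obtain ⟨b, hb⟩ : ∃ b : Module.Basis (Fin d) ℝ (EuclideanSpace ℝ (Fin d)), ∀ i, b i = a i :=
    ⟨basisOfLinearIndependentOfCardEqFinrank ha hcard, fun i => by simp⟩
  have hL : Lpt = latPt b := by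
    funext m
    rw [hLpt, latPt]
    simp [hb]
  have hDf : D = fdom b := by
    rw [hD]
    ext x
    constructor
    · rintro ⟨t, ht, rfl⟩ i
      have : ∑ i, t i • a i = ∑ i, t i • b i := by simp [hb]
      rw [this, b.repr_sum_self]
      exact ht i
    · intro hx
      refine ⟨fun i => b.repr x i, hx, ?_⟩
      simp only [← hb]
      exact (b.sum_repr x).symm
  subst hL hDf
  set ν := P.map (p 0) with hνdef
  haveI : IsProbabilityMeasure ν := Measure.isProbabilityMeasure_map (hpm 0).aemeasurable
  have hν : ∀ m, P.map (p m) = ν := by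
    intro m
    have h := hstat m {0}
    let π : (({0} : Finset (Fin d → ℤ)) → EuclideanSpace ℝ (Fin d)) → EuclideanSpace ℝ (Fin d) :=
      fun f => f ⟨0, by simp⟩
    have hπ : Measurable π := measurable_pi_apply _
    have h' := congrArg (fun M => Measure.map π M) h
    rw [Measure.map_map hπ (measurable_pi_lambda _ fun i => hpm _),
      Measure.map_map hπ (measurable_pi_lambda _ fun i => hpm _)] at h'
    have e1 : (π ∘ fun ω => fun i : ({0} : Finset (Fin d → ℤ)) => p (↑i + m) ω) = p m := by
      funext ω
      simp [π]
    have e2 : (π ∘ fun ω => fun i : ({0} : Finset (Fin d → ℤ)) => p ↑i ω) = p 0 := by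
      funext ω
      simp [π]
    rw [e1, e2] at h'
    exact h'
  have hm : ∫⁻ y, (‖y‖₊ : ENNReal) ^ (2 * q) ∂ν < ⊤ := by
    rw [hνdef, lintegral_map (by fun_prop) (hpm 0)]
    exact hmom2
  obtain ⟨C, hC, hvar⟩ := final_core P hd b p hpm ν hν U hUmeas hU hindep s q hs hq hsq hm hsum
  have hNeq : ∀ r, N r = fun ω => (nCnt b r (U ω) (fun m => p m ω)).toReal := by
    intro r
    funext ω
    rw [hN, nCnt, ENNReal.tsum_toReal_eq]
    · refine tsum_congr fun m => ?_
      rw [add_right_comm]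
      by_cases h : latPt b m + U ω + p m ω ∈ Metric.closedBall (0 : EuclideanSpace ℝ (Fin d)) r
      · simp only [Set.indicator_of_mem h, ENNReal.toReal_one]
      · simp only [Set.indicator_of_notMem h, ENNReal.toReal_zero]
    · intro m
      by_cases h : latPt b m + U ω + p m ω ∈ Metric.closedBall (0 : EuclideanSpace ℝ (Fin d)) r
      · simp only [Set.indicator_of_mem h]
        exact ENNReal.one_ne_top
      · simp only [Set.indicator_of_notMem h]
        exact ENNReal.zero_ne_top
  set V := (volume (Metric.ball (0 : EuclideanSpace ℝ (Fin d)) 1)).toReal with hV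
  have hVpos : 0 < V :=
    ENNReal.toReal_pos (Metric.measure_ball_pos volume 0 one_pos).ne' measure_ball_lt_top.ne
  refine IsBigO.of_bound (C / V) ?_
  filter_upwards [eventually_ge_atTop (1 : ℝ)] with r hr
  have hr0 : 0 < r := by linarith
  have hvol : (volume (Metric.closedBall (0 : EuclideanSpace ℝ (Fin d)) r)).toReal = r ^ d * V := by
    rw [Measure.addHaar_closedBall volume 0 hr0.le, ENNReal.toReal_mul,
      ENNReal.toReal_ofReal (by positivity)]
    simp [hV]
  have hv := hvar r hr
  rw [← hNeq r] at hv
  rw [hvol, Real.norm_of_nonneg (div_nonneg (variance_nonneg _ _) (by positivity)),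
    Real.norm_of_nonneg (by positivity), div_le_iff₀ (by positivity)]
  refine hv.trans (le_of_eq ?_)
  obtain ⟨k, rfl⟩ : ∃ k, d = k + 1 := ⟨d - 1, by omega⟩
  rw [Nat.add_sub_cancel, pow_succ]
  field_simp
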